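/- The subspaces M^e_α(Σ_D) and M^e_β(Σ_D) of M^e(Σ_D) (with the weak* topology) are each path connected and locally path connected. -/

import Mathlib

open MeasureTheory Topology Filter
open scoped ENNReal NNReal


/-! ### The alphabet of the (M,N) Dyck–Motzkin shift -/

/-- The alphabet `D = D_α ∪ D_0 ∪ D_β` of the `(M,N)` Dyck–Motzkin shift:
`la k` is the left bracket `α_k`, `u k` is the unit `1_k`, `ra k` is the right bracket `β_k`. -/
inductive DMSym (M N : ℕ) : Type where
  | la : Fin M → DMSym M N
  | u  : Fin N → DMSym M N
  | ra : Fin M → DMSym M N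
deriving DecidableEq

namespace DMSym

def equivSum (M N : ℕ) : DMSym M N ≃ (Fin M ⊕ Fin N ⊕ Fin M) where
  toFun s := match s with
    | .la k => Sum.inl k
    | .u k => Sum.inr (Sum.inl k)
    | .ra k => Sum.inr (Sum.inr k)
  invFun s := match s with
    | Sum.inl k => .la k
    | Sum.inr (Sum.inl k) => .u k
    | Sum.inr (Sum.inr k) => .ra k
  left_inv s := by cases s <;> rfl
  right_inv s := by rcases s with k | k | k <;> rfl

instance (M N : ℕ) : Fintype (DMSym M N) := Fintype.ofEquiv _ (equivSum M N).symm
instance (M N : ℕ) : TopologicalSpace (DMSym M N) := ⊥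
instance (M N : ℕ) : DiscreteTopology (DMSym M N) := ⟨rfl⟩
instance (M N : ℕ) : MeasurableSpace (DMSym M N) := ⊤
instance (M N : ℕ) : BorelSpace (DMSym M N) := ⟨borel_eq_top_of_discrete.symm⟩

end DMSym

/-- Nonzero elements of the Dyck–Motzkin monoid with zero are represented in normal form:
`some (bs, as)` is the reduced word `β_{bs(0)} ⋯ β_{bs(r)} α_{as(0)} ⋯ α_{as(s)}`
(in particular `some ([], [])` is the unit element `1`); `none` is the zero element `0`. -/
abbrev DyckElem (M : ℕ) := Option (List (Fin M) × List (Fin M))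

/-- Multiplication, in the Dyck–Motzkin monoid with zero, of an element in normal form on
the right by a generator: units are absorbed, a left bracket is appended, and a right bracket
either closes the last left bracket (if the indices match), is appended (if there is no left
bracket to close), or produces the zero element (if the indices do not match). -/
def dyckStep {M N : ℕ} : DyckElem M → DMSym M N → DyckElem M
  | none, _ => none
  | some (bs, as), .la k => some (bs, as ++ [k])
  | some (bs, as), .u _ => some (bs, as)
  | some (bs, as), .ra k =>
      match as.getLast? with
      | none => some (bs ++ [k], [])
      | some j => if j = k then some (bs, as.dropLast) else none

/-- `red w` is the image of the word `w` in the Dyck–Motzkin monoid with zero. -/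
def red {M N : ℕ} (w : List (DMSym M N)) : DyckElem M :=
  w.foldl dyckStep (some ([], []))

/-- The word `x_j x_{j+1} ⋯ x_k` read off a bi-infinite sequence `x`. -/
def wordAt {M N : ℕ} (x : ℤ → DMSym M N) (j k : ℤ) : List (DMSym M N) :=
  (List.range (k + 1 - j).toNat).map fun n => x (j + n)

/-- The `(M,N)` Dyck–Motzkin shift `Σ_D`. -/
def SigmaD (M N : ℕ) : Set (ℤ → DMSym M N) :=
  {x | ∀ j k : ℤ, j < k → red (wordAt x j k) ≠ none}

/-- The left shift `σ`. -/
def shift {A : Type*} : (ℤ → A) → (ℤ → A) := fun x i => x (i + 1)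

/-- The inverse `σ⁻¹` of the left shift. -/
def shiftInv {A : Type*} : (ℤ → A) → (ℤ → A) := fun x i => x (i - 1)

lemma wordAt_shift {M N : ℕ} (x : ℤ → DMSym M N) (j k : ℤ) :
    wordAt (shift x) j k = wordAt x (j + 1) (k + 1) := by
  simp only [wordAt, shift]
  rw [show (k + 1 + 1 - (j + 1) : ℤ) = k + 1 - j by ring]
  exact List.map_congr_left fun n _ => by rw [show (j + n + 1 : ℤ) = j + 1 + n by ring]

lemma shift_mem_SigmaD {M N : ℕ} {x : ℤ → DMSym M N} (hx : x ∈ SigmaD M N) :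
    shift x ∈ SigmaD M N := by
  intro j k hjk
  rw [wordAt_shift]
  exact hx (j + 1) (k + 1) (by omega)

/-- The left shift acting on `Σ_D`. -/
def shiftD (M N : ℕ) : ↥(SigmaD M N) → ↥(SigmaD M N) :=
  fun x => ⟨shift x.val, shift_mem_SigmaD x.property⟩

section Generic
variable {X : Type*} [MeasurableSpace X]

/-- The set of `T`-invariant Borel probability measures. -/
def InvMeas (T : X → X) : Set (ProbabilityMeasure X) :=
  {μ | MeasurePreserving T μ.toMeasure μ.toMeasure}

/-- The set of `T`-invariant ergodic Borel probability measures. -/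
def ErgMeas (T : X → X) : Set (ProbabilityMeasure X) :=
  {μ | Ergodic T μ.toMeasure}

/-- A `CO`-measure: an invariant ergodic probability measure supported on the orbit of a
single periodic point. -/
def IsCOMeas (T : X → X) (μ : ProbabilityMeasure X) : Prop :=
  Ergodic T μ.toMeasure ∧
    ∃ (x : X) (n : ℕ), 0 < n ∧ T^[n] x = x ∧
      μ.toMeasure {y | ∃ k : ℕ, y = T^[k] x} = 1

/-- Convexity for a set of probability measures: it is stable under taking the convex
combination `t•μ + (1-t)•ν` of any two of its members. -/
def ConvexMeasSet (U : Set (ProbabilityMeasure X)) : Prop :=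
  ∀ μ ∈ U, ∀ ν ∈ U, ∀ t : ℝ≥0∞, t ≤ 1 → ∀ ρ : ProbabilityMeasure X,
    ρ.toMeasure = t • μ.toMeasure + (1 - t) • ν.toMeasure → ρ ∈ U

/-- A measure is fully supported if it gives positive measure to every non-empty open set. -/
def FullSupp [TopologicalSpace X] (μ : ProbabilityMeasure X) : Prop :=
  ∀ U : Set X, IsOpen U → U.Nonempty → 0 < μ.toMeasure U

/-- Measure-theoretic isomorphism of the measure-preserving systems `(X,T,μ)` and `(Y,S,ν)`. -/
def MeasureIso {Y : Type*} [MeasurableSpace Y] (T : X → X) (S : Y → Y)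
    (μ : Measure X) (ν : Measure Y) : Prop :=
  ∃ (φ : X → Y) (ψ : Y → X), Measurable φ ∧ Measurable ψ ∧
    Measure.map φ μ = ν ∧ Measure.map ψ ν = μ ∧
    (∀ᵐ x ∂μ, ψ (φ x) = x) ∧ (∀ᵐ y ∂ν, φ (ψ y) = y) ∧
    (∀ᵐ x ∂μ, φ (T x) = S (φ x))

/-- The system `(X,T,μ)` is Bernoulli: it is measure-theoretically isomorphic to a two-sided
Bernoulli shift, i.e. the left shift on `ℤ → ℕ` equipped with an i.i.d. product measure
(determined by requiring that the measures of all cylinder sets factorize according to a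
fixed distribution `p`). -/
def IsBernoulli (T : X → X) (μ : Measure X) : Prop :=
  ∃ (p : ℕ → ℝ≥0∞) (ν : Measure (ℤ → ℕ)), (∑' n, p n) = 1 ∧
    IsProbabilityMeasure ν ∧
    (∀ (n : ℕ) (w : Fin n → ℕ) (j : ℤ),
      ν {y | ∀ i : Fin n, y (j + (i : ℕ)) = w i} = ∏ i, p (w i)) ∧
    MeasureIso T shift μ ν

end Generic

/-- `M(Σ_D)`: the space of shift-invariant Borel probability measures on `Σ_D`,
endowed with the weak* topology. -/
def MinvD (M N : ℕ) : Set (ProbabilityMeasure ↥(SigmaD M N)) := InvMeas (shiftD M N)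

/-- `M^e(Σ_D)`: the shift-invariant ergodic Borel probability measures on `Σ_D`. -/
def MergD (M N : ℕ) : Set (ProbabilityMeasure ↥(SigmaD M N)) := ErgMeas (shiftD M N)

/-- The integral `∫ f dμ`. -/
noncomputable def intCf {M N : ℕ} (f : C(↥(SigmaD M N), ℝ))
    (μ : ProbabilityMeasure ↥(SigmaD M N)) : ℝ := ∫ x, f x ∂μ.toMeasure

/-- `M_max(f)`: the set of `f`-maximizing measures, i.e. the shift-invariant measures
attaining `sup { ∫ f dν : ν ∈ M(Σ_D) }`. -/
def Mmax (M N : ℕ) (f : C(↥(SigmaD M N), ℝ)) : Set (ProbabilityMeasure ↥(SigmaD M N)) :=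
  {μ ∈ MinvD M N | ∀ ν ∈ MinvD M N, intCf f ν ≤ intCf f μ}

/-- `G_j(x)`: `1` on left brackets, `-1` on right brackets, `0` on units. -/
def Gfun {M N : ℕ} (x : ℤ → DMSym M N) (j : ℤ) : ℤ :=
  match x j with
  | .la _ => 1
  | .u _ => 0
  | .ra _ => -1

/-- `H_i(x) = Σ_{j=0}^{i-1} G_j(x)` for `i ≥ 1`, `H_i(x) = -Σ_{j=i}^{-1} G_j(x)` for
`i ≤ -1`, and `H_0(x) = 0`. -/
def Hfun {M N : ℕ} (x : ℤ → DMSym M N) (i : ℤ) : ℤ :=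
  if 0 ≤ i then ∑ j ∈ Finset.range i.toNat, Gfun x (j : ℤ)
  else -∑ j ∈ Finset.range (-i).toNat, Gfun x (i + (j : ℤ))

/-- The set `A_0`. -/
def A0set (M N : ℕ) : Set (ℤ → DMSym M N) :=
  SigmaD M N ∩ {x | ∀ i : ℤ,
    (∃ j : ℕ, 1 ≤ j ∧ Hfun x (i + (j : ℤ)) = Hfun x i) ∧
    (∃ j : ℕ, 1 ≤ j ∧ Hfun x (i - (j : ℤ)) = Hfun x i)}

/-- The set `A_α`. -/
def AalphaSet (M N : ℕ) : Set (ℤ → DMSym M N) :=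
  SigmaD M N ∩ {x | Tendsto (Hfun x) atTop atTop ∧ Tendsto (Hfun x) atBot atBot}

/-- The set `A_β`. -/
def AbetaSet (M N : ℕ) : Set (ℤ → DMSym M N) :=
  SigmaD M N ∩ {x | Tendsto (Hfun x) atTop atBot ∧ Tendsto (Hfun x) atBot atTop}

/-- `M^{CO}(Σ_D)`: the set of `CO`-measures on `Σ_D`. -/
def MCO (M N : ℕ) : Set (ProbabilityMeasure ↥(SigmaD M N)) :=
  {μ | IsCOMeas (shiftD M N) μ}

/-- `M^e_0(Σ_D) = { μ ∈ M^e(Σ_D) : μ(A_0) = 1 }`. -/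
def Me0 (M N : ℕ) : Set (ProbabilityMeasure ↥(SigmaD M N)) :=
  {μ ∈ MergD M N | μ.toMeasure (Subtype.val ⁻¹' A0set M N) = 1}

/-- `M^e_α(Σ_D) = { μ ∈ M^e(Σ_D) : μ(A_α) = 1 }`. -/
def MeAl (M N : ℕ) : Set (ProbabilityMeasure ↥(SigmaD M N)) :=
  {μ ∈ MergD M N | μ.toMeasure (Subtype.val ⁻¹' AalphaSet M N) = 1}

/-- `M^e_β(Σ_D) = { μ ∈ M^e(Σ_D) : μ(A_β) = 1 }`. -/
def MeBe (M N : ℕ) : Set (ProbabilityMeasure ↥(SigmaD M N)) :=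
  {μ ∈ MergD M N | μ.toMeasure (Subtype.val ⁻¹' AbetaSet M N) = 1}


open MeasureTheory Topology Filter
open scoped ENNReal NNReal
namespace DMP

variable {M N : ℕ}

/-! ### Combinatorics of heights and matched brackets -/

lemma H_zero (x : ℤ → DMSym M N) : Hfun x 0 = 0 := by simp [Hfun]

lemma H_succ (x : ℤ → DMSym M N) (i : ℤ) : Hfun x (i + 1) = Hfun x i + Gfun x i := by
  rcases le_or_gt 0 i with hi | hi
  · obtain ⟨n, rfl⟩ := Int.eq_ofNat_of_zero_le hi
    have h1 : ((n : ℤ) + 1).toNat = n + 1 := by omega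
    simp only [Hfun, hi, if_true, show (0 : ℤ) ≤ (n : ℤ) + 1 by omega, h1, Int.toNat_natCast,
      Finset.sum_range_succ]
  · obtain ⟨n, rfl⟩ : ∃ n : ℕ, i = -((n : ℤ) + 1) := ⟨(-i - 1).toNat, by omega⟩
    have h1 : (-(-((n : ℤ) + 1))).toNat = n + 1 := by omega
    rw [Hfun, Hfun, if_neg (by omega : ¬ (0 : ℤ) ≤ -((n : ℤ) + 1)), h1, Finset.sum_range_succ']
    rcases Nat.eq_zero_or_pos n with rfl | hn
    · simp
    · rw [if_neg (by omega)]
      have h2 : (-(-((n : ℤ) + 1) + 1)).toNat = n := by omega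
      rw [h2]
      have h3 : ∀ k : ℕ, Gfun x (-((n : ℤ) + 1) + 1 + (k : ℤ)) =
          Gfun x (-((n : ℤ) + 1) + ((k + 1 : ℕ) : ℤ)) := by
        intro k; congr 1; push_cast; ring
      simp only [h3]
      simp

lemma G_la {x : ℤ → DMSym M N} {i : ℤ} {a : Fin M} (h : x i = .la a) : Gfun x i = 1 := by
  simp [Gfun, h]

lemma G_ra {x : ℤ → DMSym M N} {i : ℤ} {a : Fin M} (h : x i = .ra a) : Gfun x i = -1 := by
  simp [Gfun, h]

lemma G_u {x : ℤ → DMSym M N} {i : ℤ} {a : Fin N} (h : x i = .u a) : Gfun x i = 0 := by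
  simp [Gfun, h]

lemma G_bd (x : ℤ → DMSym M N) (i : ℤ) : -1 ≤ Gfun x i ∧ Gfun x i ≤ 1 := by
  unfold Gfun; split <;> simp

lemma exists_la_of_G {x : ℤ → DMSym M N} {i : ℤ} (h : 0 < Gfun x i) : ∃ a, x i = .la a := by
  rcases hx : x i with a | a | a
  · exact ⟨a, rfl⟩
  · rw [G_u hx] at h; omega
  · rw [G_ra hx] at h; omega

/-- Position `i` carries a left bracket which is closed at position `j`. -/
def Matched (y : ℤ → DMSym M N) (i j : ℤ) : Prop :=
  i < j ∧ Hfun y (j + 1) = Hfun y i ∧ ∀ l, i < l → l ≤ j → Hfun y i < Hfun y l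

/-- Matched brackets have the same index. -/
def Consistent (x : ℤ → DMSym M N) : Prop :=
  ∀ i j a b, Matched x i j → x i = .la a → x j = .ra b → a = b

lemma Matched.exists_la {y : ℤ → DMSym M N} {i j : ℤ} (h : Matched y i j) : ∃ a, y i = .la a := by
  apply exists_la_of_G
  have := h.2.2 (i + 1) (by omega) (by have := h.1; omega)
  rw [H_succ] at this
  omega

lemma Matched.unique {y : ℤ → DMSym M N} {i i' j : ℤ} (h : Matched y i j) (h' : Matched y i' j) :
    i = i' := by
  have e := h.2.1
  have e' := h'.2.1
  rcases lt_trichotomy i i' with hl | hl | hl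
  · have := h.2.2 i' hl h'.1.le; omega
  · exact hl
  · have := h'.2.2 i hl h.1.le; omega

lemma red_range_succ (x : ℤ → DMSym M N) (j : ℤ) (n : ℕ) :
    red ((List.range (n + 1)).map fun m : ℕ => x (j + m)) =
      dyckStep (red ((List.range n).map fun m : ℕ => x (j + m))) (x (j + n)) := by
  simp [red, List.range_succ]

lemma wordAt_eq (x : ℤ → DMSym M N) (j k : ℤ) :
    wordAt x j k = (List.range (k + 1 - j).toNat).map fun m : ℕ => x (j + m) := by
  unfold wordAt
  simp [List.map_eq_flatMap, List.flatMap_assoc]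

lemma consistent_of_mem {x : ℤ → DMSym M N} (hx : x ∈ SigmaD M N) : Consistent x := by
  intro i j a b hm hi hj
  by_contra hab
  have key : ∀ n : ℕ, i + 1 + n ≤ j →
      red ((List.range (n + 1)).map fun m : ℕ => x (i + m)) = none ∨ ∃ rest : List (Fin M),
        red ((List.range (n + 1)).map fun m : ℕ => x (i + m)) = some ([], a :: rest) ∧
        (1 + rest.length : ℤ) = Hfun x (i + 1 + n) - Hfun x i := by
    intro n
    induction n with
    | zero =>
      intro _
      right
      refine ⟨[], ?_, ?_⟩
      · simp [red, dyckStep, hi]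
      · simp [H_succ, G_la hi]
    | succ n ih =>
      intro hn
      push_cast at hn
      rw [red_range_succ]
      rcases ih (by omega) with h | ⟨rest, h, hl⟩
      · left; rw [h]; simp [dyckStep]
      · rw [h]
        have hpos := hm.2.2 (i + 1 + n + 1) (by omega) (by omega)
        have hstep := H_succ x (i + 1 + n)
        have e1 : (i + ((n + 1 : ℕ) : ℤ)) = i + 1 + n := by push_cast; ring
        have e2 : (i + 1 + ((n + 1 : ℕ) : ℤ)) = i + 1 + n + 1 := by push_cast; ring
        rw [e1, e2]
        rcases hs : x (i + 1 + n) with k | k | k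
        · right
          refine ⟨rest ++ [k], by simp [dyckStep], ?_⟩
          rw [G_la hs] at hstep
          simp; omega
        · right
          refine ⟨rest, by simp [dyckStep], ?_⟩
          rw [G_u hs] at hstep
          omega
        · rw [G_ra hs] at hstep
          rcases List.eq_nil_or_concat rest with rfl | ⟨r', c, rfl⟩
          · simp at hl; omega
          · by_cases hck : c = k
            · right
              refine ⟨r', ?_, ?_⟩
              · subst hck
                have e3 : (a :: (r' ++ [c])).dropLast = a :: r' := by
                  rw [← List.cons_append, List.dropLast_concat]
                simp [dyckStep, List.getLast?_cons, e3]
              · simp at hl; omega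
            · left
              simp [dyckStep, List.getLast?_cons, hck]
  have hij := hm.1
  obtain ⟨n, hn⟩ : ∃ n : ℕ, j = i + 1 + n := ⟨(j - i - 1).toNat, by omega⟩
  apply hx i j hm.1
  have e : (j + 1 - i).toNat = (n + 1) + 1 := by omega
  rw [wordAt_eq, e, red_range_succ]
  have e1 : (i + ((n + 1 : ℕ) : ℤ)) = j := by push_cast; omega
  rw [e1, hj]
  rcases key n (by omega) with h | ⟨rest, h, hl⟩
  · rw [h]; simp [dyckStep]
  · rw [h]
    have := H_succ x j
    rw [G_ra hj, hm.2.1] at this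
    rw [← hn] at hl
    have hr : rest = [] := List.length_eq_zero_iff.1 (by omega)
    subst hr
    simp [dyckStep, hab]

lemma mem_of_consistent {x : ℤ → DMSym M N} (hx : Consistent x) : x ∈ SigmaD M N := by
  have key : ∀ (j : ℤ) (n : ℕ), ∃ bs as,
      red ((List.range n).map fun m : ℕ => x (j + m)) = some (bs, as) ∧
      ∀ pre k post, as = pre ++ k :: post → ∃ i < j + n, x i = .la k ∧
        Hfun x (j + n) = Hfun x i + 1 + post.length ∧
        ∀ l, i < l → l ≤ j + n → Hfun x i < Hfun x l := by
    intro j n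
    induction n with
    | zero => exact ⟨[], [], by simp [red], by simp⟩
    | succ n ih =>
      obtain ⟨bs, as, h, hst⟩ := ih
      rw [red_range_succ, h]
      have e1 : (j + ((n + 1 : ℕ) : ℤ)) = j + n + 1 := by push_cast; ring
      rw [e1]
      set p := j + (n : ℤ) with hp
      have hstep := H_succ x p
      rcases hs : x p with k | k | k
      · rw [G_la hs] at hstep
        refine ⟨bs, as ++ [k], by simp [dyckStep], ?_⟩
        intro pre c post he
        rcases List.eq_nil_or_concat post with rfl | ⟨post', d, rfl⟩
        · have := List.append_inj' he (by simp)
          obtain ⟨h1, h2⟩ := this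
          simp at h2
          subst h2
          refine ⟨p, by omega, hs, by simp; omega, ?_⟩
          intro l hl hl'
          have : l = p + 1 := by omega
          subst this; omega
        · have he' : as ++ [k] = (pre ++ c :: post') ++ [d] := by simpa using he
          obtain ⟨h1, h2⟩ := List.append_inj' he' (by simp)
          obtain ⟨i, hi, hxi, hH, hl⟩ := hst pre c post' h1
          refine ⟨i, by omega, hxi, by simp; omega, ?_⟩
          intro l h3 h4
          rcases eq_or_lt_of_le h4 with h5 | h5
          · subst h5
            have := hl p hi le_rfl
            omega
          · exact hl l h3 (by omega)
      · rw [G_u hs] at hstep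
        refine ⟨bs, as, by simp [dyckStep], ?_⟩
        intro pre c post he
        obtain ⟨i, hi, hxi, hH, hl⟩ := hst pre c post he
        refine ⟨i, by omega, hxi, by omega, ?_⟩
        intro l h3 h4
        rcases eq_or_lt_of_le h4 with h5 | h5
        · subst h5
          have := hl p hi le_rfl
          omega
        · exact hl l h3 (by omega)
      · rw [G_ra hs] at hstep
        rcases List.eq_nil_or_concat as with rfl | ⟨as', a, rfl⟩
        · exact ⟨bs ++ [k], [], by simp [dyckStep], by simp⟩
        · obtain ⟨i, hi, hxi, hH, hl⟩ := hst as' a [] (by simp)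
          have hak : a = k := by
            refine hx i p a k ⟨hi, ?_, hl⟩ hxi hs
            simp at hH; omega
          subst hak
          refine ⟨bs, as', by simp [dyckStep], ?_⟩
          intro pre c post he
          obtain ⟨i, hi, hxi, hH, hl⟩ := hst pre c (post ++ [a]) (by simp [he])
          simp at hH
          refine ⟨i, by omega, hxi, by omega, ?_⟩
          intro l h3 h4
          rcases eq_or_lt_of_le h4 with h5 | h5
          · subst h5; omega
          · exact hl l h3 (by omega)
  intro j k _
  obtain ⟨bs, as, h, -⟩ := key j (k + 1 - j).toNat
  rw [wordAt_eq, h]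
  simp

lemma mem_iff (x : ℤ → DMSym M N) : x ∈ SigmaD M N ↔ Consistent x :=
  ⟨consistent_of_mem, mem_of_consistent⟩

/-- If `x` and `y` have the same heights, they have the same matched brackets. -/
lemma H_congr {x y : ℤ → DMSym M N} (h : ∀ i, Gfun x i = Gfun y i) : Hfun x = Hfun y := by
  funext i; simp [Hfun, h]

lemma H_shift (x : ℤ → DMSym M N) (i : ℤ) : Hfun (shift x) i = Hfun x (i + 1) - Hfun x 1 := by
  have hG : ∀ i, Gfun (shift x) i = Gfun x (i + 1) := fun i => rfl
  induction i using Int.induction_on with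
  | zero => simp [H_zero]
  | succ n ih => rw [H_succ, ih, hG, H_succ x ((n : ℤ) + 1)]; ring
  | pred n ih =>
    have h1 := H_succ (shift x) (-(n : ℤ) - 1)
    have h2 := H_succ x (-(n : ℤ) - 1 + 1)
    rw [hG] at h1
    rw [show (-(n : ℤ) - 1 + 1) = -(n : ℤ) by ring] at *
    omega

lemma matched_shift (y : ℤ → DMSym M N) (i j : ℤ) :
    Matched (shift y) i j ↔ Matched y (i + 1) (j + 1) := by
  simp only [Matched, H_shift]
  constructor
  · rintro ⟨h1, h2, h3⟩
    refine ⟨by omega, by omega, fun l h4 h5 => ?_⟩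
    have := h3 (l - 1) (by omega) (by omega)
    rw [sub_add_cancel] at this
    omega
  · rintro ⟨h1, h2, h3⟩
    refine ⟨by omega, by omega, fun l h4 h5 => ?_⟩
    have := h3 (l + 1) (by omega) (by omega)
    omega

lemma H_local {y y' : ℤ → DMSym M N} {i j : ℤ} (h : ∀ l, i ≤ l → l ≤ j → y l = y' l) (l : ℤ)
    (h1 : i ≤ l) (h2 : l ≤ j + 1) : Hfun y l - Hfun y i = Hfun y' l - Hfun y' i := by
  induction l, h1 using Int.leInduction with
  | base => simp
  | succ n hn ih =>
    have hG : Gfun y n = Gfun y' n := by simp [Gfun, h n hn (by omega)]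
    rw [H_succ, H_succ, hG]
    have := ih (by omega)
    omega

lemma matched_local {y y' : ℤ → DMSym M N} {i j : ℤ} (h : ∀ l, i ≤ l → l ≤ j → y l = y' l)
    (hm : Matched y i j) : Matched y' i j := by
  have hl := H_local h
  have hij := hm.1
  refine ⟨hm.1, ?_, fun l h1 h2 => ?_⟩
  · have := hl (j + 1) (by omega) le_rfl
    have := hm.2.1
    omega
  · have := hl l h1.le (by omega)
    have := hm.2.2 l h1 h2
    omega

/-- If the height tends to `-∞` in the past, every right bracket is matched. -/
lemma exists_matched {y : ℤ → DMSym M N} (h : Tendsto (Hfun y) atBot atBot) {j : ℤ} {k : Fin M}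
    (hj : y j = .ra k) : ∃ i, Matched y i j := by
  have hex : ∃ n : ℕ, Hfun y (j - n) ≤ Hfun y (j + 1) := by
    obtain ⟨b, hb⟩ := (h.eventually (eventually_le_atBot (Hfun y (j + 1)))).exists_forall_of_atBot
    exact ⟨(j - b).toNat, hb _ (by omega)⟩
  classical
  have hs := Nat.find_spec hex
  have hmin := fun m => Nat.find_min (m := m) hex
  set n := Nat.find hex
  have hstep := H_succ y j
  rw [G_ra hj] at hstep
  have hn : n ≠ 0 := by
    intro h0
    rw [h0] at hs
    simp at hs; omega
  have hgt : ∀ l, j - n < l → l ≤ j → Hfun y (j + 1) < Hfun y l := by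
    intro l h1 h2
    have := hmin (j - l).toNat (by omega)
    rw [show j - ((j - l).toNat : ℤ) = l by omega] at this
    omega
  have heq : Hfun y (j + 1) = Hfun y (j - n) := by
    have h1 := hgt (j - n + 1) (by omega) (by omega)
    have h2 := H_succ y (j - n)
    have := G_bd y (j - n)
    omega
  exact ⟨j - n, by omega, heq, fun l h1 h2 => heq ▸ hgt l h1 h2⟩

/-! ### Decoding -/

open Classical in
/-- Change the index of each matched right bracket to that of its left bracket. -/
noncomputable def dec (y : ℤ → DMSym M N) (j : ℤ) : DMSym M N :=
  match y j with
  | .la k => .la k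
  | .u k => .u k
  | .ra k => if h : ∃ a i, Matched y i j ∧ y i = .la a then .ra h.choose else .ra k

lemma dec_la {y : ℤ → DMSym M N} {j : ℤ} {k : Fin M} (h : y j = .la k) : dec y j = .la k := by
  simp [dec, h]

lemma dec_u {y : ℤ → DMSym M N} {j : ℤ} {k : Fin N} (h : y j = .u k) : dec y j = .u k := by
  simp [dec, h]

lemma dec_matched {y : ℤ → DMSym M N} {i j : ℤ} {a k : Fin M} (h : y j = .ra k)
    (hm : Matched y i j) (hi : y i = .la a) : dec y j = .ra a := by
  have hex : ∃ a i, Matched y i j ∧ y i = .la a := ⟨a, i, hm, hi⟩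
  simp only [dec, h, dif_pos hex]
  obtain ⟨i', hm', hi'⟩ := hex.choose_spec
  rw [hm'.unique hm, hi] at hi'
  injection hi' with e
  rw [← e]

lemma dec_unmatched {y : ℤ → DMSym M N} {j : ℤ} {k : Fin M} (h : y j = .ra k)
    (hm : ¬ ∃ i, Matched y i j) : dec y j = .ra k := by
  have hex : ¬ ∃ a i, Matched y i j ∧ y i = .la a := fun ⟨a, i, hi, _⟩ => hm ⟨i, hi⟩
  simp only [dec, h, dif_neg hex]

lemma G_dec (y : ℤ → DMSym M N) (j : ℤ) : Gfun (dec y) j = Gfun y j := by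
  rcases hs : y j with k | k | k
  · rw [G_la (dec_la hs), G_la hs]
  · rw [G_u (dec_u hs), G_u hs]
  · by_cases hm : ∃ i, Matched y i j
    · obtain ⟨i, hi⟩ := hm
      obtain ⟨a, ha⟩ := hi.exists_la
      rw [G_ra (dec_matched hs hi ha), G_ra hs]
    · rw [G_ra (dec_unmatched hs hm), G_ra hs]

lemma H_dec (y : ℤ → DMSym M N) : Hfun (dec y) = Hfun y := H_congr (G_dec y)

lemma dec_la_iff {y : ℤ → DMSym M N} {j : ℤ} {k : Fin M} : dec y j = .la k ↔ y j = .la k := by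
  refine ⟨fun h => ?_, dec_la⟩
  obtain ⟨a, ha⟩ := exists_la_of_G (x := y) (i := j) (by rw [← G_dec, G_la h]; simp)
  rw [dec_la ha] at h
  rw [ha, h]

lemma dec_u_iff {y : ℤ → DMSym M N} {j : ℤ} {k : Fin N} : dec y j = .u k ↔ y j = .u k := by
  refine ⟨fun h => ?_, dec_u⟩
  have hg := G_dec y j
  rw [G_u h] at hg
  rcases hs : y j with a | a | a
  · rw [G_la hs] at hg; omega
  · rw [dec_u hs] at h; rw [h]
  · rw [G_ra hs] at hg; omega

lemma dec_ra_iff {y : ℤ → DMSym M N} {j : ℤ} {b : Fin M} : dec y j = .ra b ↔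
    (∃ k, y j = .ra k) ∧ ((∃ i, Matched y i j ∧ y i = .la b) ∨
      ((¬ ∃ i, Matched y i j) ∧ y j = .ra b)) := by
  rcases hs : y j with k | k | k
  · simp [dec_la hs]
  · simp [dec_u hs]
  · by_cases hm : ∃ i, Matched y i j
    · have hm0 := hm
      obtain ⟨i, hi⟩ := hm
      obtain ⟨a, ha⟩ := hi.exists_la
      rw [dec_matched hs hi ha]
      constructor
      · intro h
        injection h with h
        subst h
        exact ⟨⟨k, rfl⟩, Or.inl ⟨i, hi, ha⟩⟩
      · rintro ⟨-, ⟨i', h1, h2⟩ | ⟨h1, -⟩⟩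
        · rw [h1.unique hi, ha] at h2
          injection h2 with h2
          rw [h2]
        · exact absurd hm0 h1
    · rw [dec_unmatched hs hm]
      constructor
      · intro h; exact ⟨⟨k, rfl⟩, Or.inr ⟨hm, h⟩⟩
      · rintro ⟨-, ⟨i', h1, h2⟩ | ⟨h1, h⟩⟩
        · exact absurd ⟨i', h1⟩ hm
        · exact h

lemma dec_mem (y : ℤ → DMSym M N) : dec y ∈ SigmaD M N := by
  rw [mem_iff]
  intro i j a b hm hi hj
  have hm' : Matched y i j := by
    unfold Matched at hm ⊢; rwa [H_dec] at hm
  rw [dec_la_iff] at hi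
  rw [dec_ra_iff] at hj
  obtain ⟨⟨k, hk⟩, -⟩ := id hj
  have h1 := dec_matched hk hm' hi
  have h2 := dec_ra_iff.2 hj
  rw [h1] at h2
  injection h2

lemma dec_eq_self {x : ℤ → DMSym M N} (hx : x ∈ SigmaD M N) : dec x = x := by
  rw [mem_iff] at hx
  funext j
  rcases hs : x j with k | k | k
  · exact dec_la hs
  · exact dec_u hs
  · by_cases hm : ∃ i, Matched x i j
    · obtain ⟨i, hi⟩ := hm
      obtain ⟨a, ha⟩ := hi.exists_la
      rw [dec_matched hs hi ha, hx i j a k hi ha hs]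
    · exact dec_unmatched hs hm

lemma dec_shift (y : ℤ → DMSym M N) : dec (shift y) = shift (dec y) := by
  funext j
  show dec (shift y) j = dec y (j + 1)
  rcases hs : y (j + 1) with k | k | k
  · rw [dec_la hs, dec_la (y := shift y) hs]
  · rw [dec_u hs, dec_u (y := shift y) hs]
  · by_cases hm : ∃ i, Matched y i (j + 1)
    · obtain ⟨i, hi⟩ := hm
      obtain ⟨a, ha⟩ := hi.exists_la
      rw [dec_matched hs hi ha]
      refine dec_matched (y := shift y) (i := i - 1) hs ?_ ?_
      · rw [matched_shift]; simpa using hi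
      · simpa [shift] using ha
    · rw [dec_unmatched hs hm]
      refine dec_unmatched (y := shift y) hs ?_
      rintro ⟨i, hi⟩
      rw [matched_shift] at hi
      exact hm ⟨_, hi⟩

/-- Local constancy of the decoding at points all of whose right brackets are matched. -/
lemma dec_local {y : ℤ → DMSym M N} (h : Tendsto (Hfun y) atBot atBot) (j : ℤ) :
    ∃ i, ∀ y' : ℤ → DMSym M N, (∀ l, i ≤ l → l ≤ j → y l = y' l) → dec y' j = dec y j := by
  rcases hs : y j with k | k | k
  · refine ⟨j, fun y' h' => ?_⟩
    rw [dec_la hs, dec_la (y := y') (by rw [← h' j le_rfl le_rfl, hs])]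
  · refine ⟨j, fun y' h' => ?_⟩
    rw [dec_u hs, dec_u (y := y') (by rw [← h' j le_rfl le_rfl, hs])]
  · obtain ⟨i, hi⟩ := exists_matched h hs
    refine ⟨i, fun y' h' => ?_⟩
    obtain ⟨a, ha⟩ := hi.exists_la
    have hij := hi.1
    rw [dec_matched hs hi ha, dec_matched (y := y') (i := i) (k := k) (a := a)
      (by rw [← h' j hij.le le_rfl, hs]) (matched_local h' hi)
      (by rw [← h' i le_rfl hij.le, ha])]

end DMP

open MeasureTheory Topology Filter
open scoped ENNReal NNReal
namespace DMP

set_option linter.unusedSectionVars false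

/-! ### Generic ergodic theory -/

section Erg
variable {Ω : Type*} [MeasurableSpace Ω] {μ : Measure Ω} [IsProbabilityMeasure μ] {T : Ω → Ω}

lemma hasSum_measureReal_iUnion {f : ℕ → Set Ω} (hd : Pairwise (Function.onFun Disjoint f))
    (hf : ∀ i, MeasurableSet (f i)) : HasSum (fun i => μ.real (f i)) (μ.real (⋃ i, f i)) := by
  have h : μ.real (⋃ i, f i) = ∑' i, μ.real (f i) := by
    rw [Measure.real, measure_iUnion hd hf, ENNReal.tsum_toReal_eq fun i => measure_ne_top μ _]
    rfl
  rw [h]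
  exact (summable_measure_toReal hf hd).hasSum

/-- Ergodicity from eventual independence along a generating pi-system. -/
lemma ergodic_of_piSystem (hT : MeasurePreserving T μ μ) (C : Set (Set Ω)) (hC : IsPiSystem C)
    (hgen : ‹MeasurableSpace Ω› = MeasurableSpace.generateFrom C)
    (hmix : ∀ A ∈ C, ∀ B ∈ C, ∀ᶠ n : ℕ in atTop, μ ((T^[n]) ⁻¹' A ∩ B) = μ A * μ B) :
    Ergodic T μ := by
  have hCm : ∀ A ∈ C, MeasurableSet A := fun A hA => by
    rw [hgen]; exact MeasurableSpace.measurableSet_generateFrom hA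
  have hTn : ∀ n : ℕ, MeasurePreserving (T^[n]) μ μ := fun n => hT.iterate n
  have step : ∀ B ∈ C, ∀ A, MeasurableSet A →
      Tendsto (fun n : ℕ => μ.real ((T^[n]) ⁻¹' A ∩ B)) atTop (𝓝 (μ.real A * μ.real B)) := by
    intro B hB A hA
    have hBm := hCm B hB
    induction A, hA using MeasurableSpace.induction_on_inter hgen hC with
    | empty => simp
    | basic A hA =>
      refine tendsto_const_nhds.congr' ?_
      filter_upwards [hmix A hA B hB] with n hn
      rw [Measure.real, Measure.real, Measure.real, hn, ENNReal.toReal_mul]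
    | compl A hA ih =>
      have h1 : ∀ n : ℕ, μ.real ((T^[n]) ⁻¹' Aᶜ ∩ B) = μ.real B - μ.real ((T^[n]) ⁻¹' A ∩ B) := by
        intro n
        have := measureReal_inter_add_sdiff (μ := μ) (s := B) (((hTn n).measurable) hA)
        rw [Set.preimage_compl, Set.inter_comm, ← Set.sdiff_eq, Set.inter_comm]
        linarith
      simp only [h1]
      have h2 : μ.real Aᶜ * μ.real B = μ.real B - μ.real A * μ.real B := by
        rw [probReal_compl_eq_one_sub hA]; ring
      rw [h2]
      exact tendsto_const_nhds.sub ih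
    | iUnion f hd hf ih =>
      have hsum : Summable fun i => μ.real (f i) :=
        (hasSum_measureReal_iUnion hd hf).summable
      have h1 : ∀ n : ℕ, μ.real ((T^[n]) ⁻¹' (⋃ i, f i) ∩ B) =
          ∑' i, μ.real ((T^[n]) ⁻¹' (f i) ∩ B) := by
        intro n
        rw [Set.preimage_iUnion, Set.iUnion_inter]
        refine (hasSum_measureReal_iUnion ?_ ?_).tsum_eq.symm
        · intro i j hij
          exact ((hd hij).preimage _).mono Set.inter_subset_left Set.inter_subset_left
        · intro i
          exact ((hTn n).measurable (hf i)).inter hBm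
      have h2 : μ.real (⋃ i, f i) * μ.real B = ∑' i, μ.real (f i) * μ.real B := by
        rw [tsum_mul_right, (hasSum_measureReal_iUnion hd hf).tsum_eq]
      simp only [h1, h2]
      refine tendsto_tsum_of_dominated_convergence hsum ih ?_
      refine Eventually.of_forall fun n i => ?_
      rw [Real.norm_of_nonneg measureReal_nonneg]
      calc μ.real ((T^[n]) ⁻¹' (f i) ∩ B) ≤ μ.real ((T^[n]) ⁻¹' (f i)) :=
            measureReal_mono Set.inter_subset_left
        _ = μ.real (f i) := (hTn n).measureReal_preimage (hf i).nullMeasurableSet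
  refine ⟨hT, ⟨fun E hE hinv => ?_⟩⟩
  have hEn : ∀ n : ℕ, (T^[n]) ⁻¹' E = E := fun n => Function.IsFixedPt.preimage_iterate hinv n
  have h1 : ∀ B ∈ C, μ (E ∩ B) = μ E * μ B := by
    intro B hB
    have := step B hB E hE
    simp only [hEn] at this
    have := tendsto_nhds_unique tendsto_const_nhds this
    rw [Measure.real, Measure.real, Measure.real, ← ENNReal.toReal_mul] at this
    exact (ENNReal.toReal_eq_toReal_iff' (by finiteness) (by finiteness)).1 this
  have h2 : μ.restrict E = μ E • μ := by
    refine ext_of_generate_finite C hgen hC ?_ ?_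
    · intro B hB
      rw [Measure.restrict_apply (hCm B hB), Set.inter_comm, h1 B hB]; rfl
    · simp
  have h3 : μ E = μ E * μ E := by
    have := congrArg (fun m => m E) h2
    simpa using this
  rw [eventuallyConst_set']
  by_cases h0 : μ E = 0
  · left; exact ae_eq_empty.2 h0
  · right
    have : μ E = 1 := by
      have h4 : μ E * 1 = μ E * μ E := by simpa using h3
      exact ((ENNReal.mul_right_inj h0 (by finiteness)).1 h4).symm
    exact ae_eq_univ.2 ((prob_compl_eq_zero_iff hE).2 this)

/-- Running minima of the Birkhoff sums. -/
def rmin (T : Ω → Ω) (g : Ω → ℤ) : ℕ → Ω → ℤ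
  | 0, _ => 0
  | n + 1, ω => min 0 (g ω + rmin T g n (T ω))

lemma rmin_le_zero (g : Ω → ℤ) (n : ℕ) (ω : Ω) : rmin T g n ω ≤ 0 := by
  cases n <;> simp [rmin]

lemma rmin_succ_le (g : Ω → ℤ) (n : ℕ) (ω : Ω) : rmin T g (n + 1) ω ≤ rmin T g n ω := by
  induction n generalizing ω with
  | zero => simp [rmin]
  | succ n ih =>
    have := ih (T ω)
    have e1 : rmin T g (n + 1 + 1) ω = min 0 (g ω + rmin T g (n + 1) (T ω)) := rfl
    have e2 : rmin T g (n + 1) ω = min 0 (g ω + rmin T g n (T ω)) := rfl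
    omega

lemma rmin_succ_ge {g : Ω → ℤ} (hg : ∀ ω, -1 ≤ g ω ∧ g ω ≤ 1) (n : ℕ) (ω : Ω) :
    rmin T g n ω - 1 ≤ rmin T g (n + 1) ω := by
  induction n generalizing ω with
  | zero => have := hg ω; simp [rmin]; omega
  | succ n ih =>
    have := ih (T ω)
    have := hg ω
    have e1 : rmin T g (n + 1 + 1) ω = min 0 (g ω + rmin T g (n + 1) (T ω)) := rfl
    have e2 : rmin T g (n + 1) ω = min 0 (g ω + rmin T g n (T ω)) := rfl
    omega

lemma rmin_bd {g : Ω → ℤ} (hg : ∀ ω, -1 ≤ g ω ∧ g ω ≤ 1) (n : ℕ) (ω : Ω) :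
    -(n : ℤ) ≤ rmin T g n ω := by
  induction n with
  | zero => simp [rmin]
  | succ n ih =>
    have := rmin_succ_ge (T := T) hg n ω
    push_cast
    omega

lemma rmin_meas (hT : Measurable T) {g : Ω → ℤ} (hg : Measurable g) (n : ℕ) :
    Measurable (rmin T g n) := by
  induction n with
  | zero => exact measurable_const
  | succ n ih =>
    have h : Measurable fun ω => g ω + rmin T g n (T ω) := hg.add (ih.comp hT)
    exact measurable_const.min h

lemma rmin_le_sum (g : Ω → ℤ) (k n : ℕ) (hkn : k ≤ n) (ω : Ω) :
    rmin T g n ω ≤ birkhoffSum T g k ω := by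
  induction n generalizing k ω with
  | zero => obtain rfl : k = 0 := by omega
            simp [rmin]
  | succ n ih =>
    cases k with
    | zero => simpa using rmin_le_zero g (n + 1) ω
    | succ k =>
      have := ih k (by omega) (T ω)
      rw [birkhoffSum_succ', rmin]
      omega

lemma le_rmin (g : Ω → ℤ) (n : ℕ) (b : ℤ) (ω : Ω) (h : ∀ k, b ≤ birkhoffSum T g k ω) :
    b ≤ rmin T g n ω := by
  induction n generalizing b ω with
  | zero => simpa [rmin] using h 0
  | succ n ih =>
    have h0 := h 0
    have := ih (b - g ω) (T ω) fun k => by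
      have := h (k + 1)
      rw [birkhoffSum_succ'] at this
      omega
    rw [rmin]
    simp at h0
    omega

/-- Points from which the Birkhoff sums stay positive. -/
def Up (T : Ω → Ω) (g : Ω → ℤ) : Set Ω := {ω | ∀ k : ℕ, 1 ≤ birkhoffSum T g (k + 1) ω}

lemma mem_Up_iff (g : Ω → ℤ) (ω : Ω) :
    ω ∈ Up T g ↔ ∀ n, 1 ≤ g ω + rmin T g n (T ω) := by
  constructor
  · intro h n
    have := le_rmin (T := T) g n (1 - g ω) (T ω) fun k => by
      have := h k
      rw [birkhoffSum_succ'] at this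
      omega
    omega
  · intro h k
    have h1 := h k
    have := rmin_le_sum (T := T) g k k le_rfl (T ω)
    rw [birkhoffSum_succ']
    omega

lemma bsum_meas (hT : Measurable T) {g : Ω → ℤ} (hg : Measurable g) (n : ℕ) :
    Measurable (birkhoffSum T g n) := by
  unfold birkhoffSum
  exact Finset.measurable_fun_sum _ fun k _ => hg.comp (hT.iterate k)

lemma Up_meas (hT : Measurable T) {g : Ω → ℤ} (hg : Measurable g) : MeasurableSet (Up T g) := by
  rw [Up, Set.ofPred_forall]
  exact MeasurableSet.iInter fun k =>
    measurableSet_le measurable_const (bsum_meas hT hg (k + 1))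

/-- positive part -/
def posn (T : Ω → Ω) (g : Ω → ℤ) (n : ℕ) (ω : Ω) : ℤ := max 0 (g ω + rmin T g n (T ω))

lemma posn_bd {g : Ω → ℤ} (hg : ∀ ω, -1 ≤ g ω ∧ g ω ≤ 1) (n : ℕ) (ω : Ω) :
    0 ≤ posn T g n ω ∧ posn T g n ω ≤ 1 := by
  have := rmin_le_zero (T := T) g n (T ω)
  have := hg ω
  unfold posn; omega

lemma integrable_int {f : Ω → ℤ} (hf : Measurable f) (c : ℤ) (hc : ∀ ω, |f ω| ≤ c) :
    Integrable (fun ω => (f ω : ℝ)) μ := by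
  refine Integrable.of_bound (C := c) (measurable_from_top.comp hf).aestronglyMeasurable ?_
  refine Eventually.of_forall fun ω => ?_
  rw [Real.norm_eq_abs]
  exact_mod_cast hc ω

lemma posn_meas (hT : Measurable T) {g : Ω → ℤ} (hg : Measurable g) (n : ℕ) :
    Measurable (posn T g n) :=
  measurable_const.max (hg.add ((rmin_meas hT hg n).comp hT))

lemma integral_g_eq (hT : MeasurePreserving T μ μ) {g : Ω → ℤ} (hgm : Measurable g)
    (hg : ∀ ω, -1 ≤ g ω ∧ g ω ≤ 1) (n : ℕ) :
    ∫ ω, (g ω : ℝ) ∂μ = ∫ ω, (posn T g n ω : ℝ) ∂μ +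
      ∫ ω, ((rmin T g (n + 1) ω - rmin T g n ω : ℤ) : ℝ) ∂μ := by
  have ig : Integrable (fun ω => (g ω : ℝ)) μ :=
    integrable_int hgm 1 fun ω => abs_le.2 (hg ω)
  have im : ∀ n, Integrable (fun ω => (rmin T g n ω : ℝ)) μ := fun n =>
    integrable_int (rmin_meas hT.measurable hgm n) n fun ω => abs_le.2
      ⟨rmin_bd hg n ω, (rmin_le_zero g n ω).trans (by positivity)⟩
  have ip : Integrable (fun ω => (posn T g n ω : ℝ)) μ :=
    integrable_int (posn_meas hT.measurable hgm n) 1 fun ω => abs_le.2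
      ⟨by have := (posn_bd (T := T) hg n ω).1; omega, (posn_bd hg n ω).2⟩
  have imT : Integrable (fun ω => (rmin T g n (T ω) : ℝ)) μ :=
    hT.integrable_comp_of_integrable (im n)
  have e1 : ∫ ω, (rmin T g n (T ω) : ℝ) ∂μ = ∫ ω, (rmin T g n ω : ℝ) ∂μ := by
    have := integral_map (μ := μ) hT.measurable.aemeasurable
      (f := fun ω => (rmin T g n ω : ℝ)) (by rw [hT.map_eq]; exact (im n).aestronglyMeasurable)
    rw [hT.map_eq] at this
    exact this.symm
  have e2 : ∫ ω, ((g ω : ℝ) + (rmin T g n (T ω) : ℝ)) ∂μ =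
      ∫ ω, ((posn T g n ω : ℝ) + (rmin T g (n + 1) ω : ℝ)) ∂μ := by
    refine integral_congr_ae (Eventually.of_forall fun ω => ?_)
    have : g ω + rmin T g n (T ω) = posn T g n ω + rmin T g (n + 1) ω := by
      rw [posn, rmin]; omega
    show (g ω : ℝ) + (rmin T g n (T ω) : ℝ) = (posn T g n ω : ℝ) + (rmin T g (n + 1) ω : ℝ)
    exact_mod_cast this
  rw [integral_add ig imT, integral_add ip (im (n + 1)), e1] at e2
  have e3 : ∫ ω, ((rmin T g (n + 1) ω - rmin T g n ω : ℤ) : ℝ) ∂μ =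
      ∫ ω, (rmin T g (n + 1) ω : ℝ) ∂μ - ∫ ω, (rmin T g n ω : ℝ) ∂μ := by
    rw [← integral_sub (im _) (im _)]
    simp
  rw [e3]
  linarith

lemma tendsto_posn (hT : MeasurePreserving T μ μ) {g : Ω → ℤ} (hgm : Measurable g)
    (hg : ∀ ω, -1 ≤ g ω ∧ g ω ≤ 1) :
    Tendsto (fun n => ∫ ω, (posn T g n ω : ℝ) ∂μ) atTop (𝓝 (μ.real (Up T g))) := by
  have hU := Up_meas hT.measurable hgm
  rw [← integral_indicator_one hU]
  refine tendsto_integral_of_dominated_convergence (fun _ => (1 : ℝ)) ?_ (integrable_const _) ?_ ?_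
  · intro n
    exact (measurable_from_top.comp (posn_meas hT.measurable hgm n)).aestronglyMeasurable
  · intro n
    refine Eventually.of_forall fun ω => ?_
    have := posn_bd (T := T) hg n ω
    rw [Real.norm_of_nonneg (by exact_mod_cast this.1)]
    exact_mod_cast this.2
  · refine Eventually.of_forall fun ω => ?_
    by_cases hω : ω ∈ Up T g
    · rw [Set.indicator_of_mem hω]
      refine tendsto_const_nhds.congr fun n => ?_
      have h1 := (mem_Up_iff g ω).1 hω n
      have h2 := posn_bd (T := T) hg n ω
      have : posn T g n ω = 1 := by unfold posn at *; omega
      rw [this]; simp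
    · rw [Set.indicator_of_notMem hω]
      rw [mem_Up_iff] at hω
      push Not at hω
      obtain ⟨n0, hn0⟩ := hω
      refine tendsto_const_nhds.congr' ?_
      filter_upwards [eventually_ge_atTop n0] with n hn
      have : rmin T g n (T ω) ≤ rmin T g n0 (T ω) :=
        antitone_nat_of_succ_le (f := fun n => rmin T g n (T ω))
          (fun n => rmin_succ_le g n (T ω)) hn
      have : posn T g n ω = 0 := by unfold posn; omega
      rw [this]; simp

/-- Transience to `+∞` forces positive drift. -/
lemma drift_pos (hT : MeasurePreserving T μ μ) {g : Ω → ℤ} (hgm : Measurable g)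
    (hg : ∀ ω, -1 ≤ g ω ∧ g ω ≤ 1)
    (h : ∀ᵐ ω ∂μ, Tendsto (fun n => birkhoffSum T g n ω) atTop atTop) :
    0 < ∫ ω, (g ω : ℝ) ∂μ := by
  have hdiff : Tendsto (fun n => ∫ ω, ((rmin T g (n + 1) ω - rmin T g n ω : ℤ) : ℝ) ∂μ)
      atTop (𝓝 0) := by
    have : (0 : ℝ) = ∫ _ω : Ω, (0 : ℝ) ∂μ := by simp
    rw [this]
    refine tendsto_integral_of_dominated_convergence (fun _ => (1 : ℝ)) ?_
      (integrable_const _) ?_ ?_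
    · intro n
      exact (measurable_from_top.comp ((rmin_meas hT.measurable hgm (n + 1)).sub
        (rmin_meas hT.measurable hgm n))).aestronglyMeasurable
    · intro n
      refine Eventually.of_forall fun ω => ?_
      have h1 := rmin_succ_ge (T := T) hg n ω
      have h2 := rmin_succ_le (T := T) g n ω
      rw [Real.norm_eq_abs]
      have : |rmin T g (n + 1) ω - rmin T g n ω| ≤ 1 := abs_le.2 (by omega)
      exact_mod_cast this
    · filter_upwards [h] with ω hω
      obtain ⟨b, hb⟩ : ∃ b, ∀ k, b ≤ birkhoffSum T g k ω := by
        obtain ⟨b, hb⟩ := bddBelow_range_of_tendsto_atTop_atTop hω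
        exact ⟨b, fun k => hb ⟨k, rfl⟩⟩
      have hlim : Tendsto (fun n => (rmin T g n ω : ℝ)) atTop
          (𝓝 (⨅ n, (rmin T g n ω : ℝ))) := by
        refine tendsto_atTop_ciInf ?_ ?_
        · refine antitone_nat_of_succ_le fun n => ?_
          exact_mod_cast rmin_succ_le g n ω
        · refine ⟨b, ?_⟩
          rintro _ ⟨n, rfl⟩
          show (b : ℝ) ≤ (rmin T g n ω : ℝ)
          exact_mod_cast le_rmin g n b ω hb
      have h2 := (hlim.comp (tendsto_add_atTop_nat 1)).sub hlim
      rw [sub_self] at h2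
      refine h2.congr fun n => ?_
      simp
  have hlim := (tendsto_posn hT hgm hg).add hdiff
  rw [add_zero] at hlim
  have heq : ∫ ω, (g ω : ℝ) ∂μ = μ.real (Up T g) :=
    tendsto_nhds_unique (tendsto_const_nhds.congr fun n => integral_g_eq hT hgm hg n) hlim
  rw [heq]
  refine lt_of_le_of_ne measureReal_nonneg fun h0 => ?_
  have h0' : μ (Up T g) = 0 := (measureReal_eq_zero_iff).1 h0.symm
  have hnot : ∀ᵐ ω ∂μ, ∀ n : ℕ, T^[n] ω ∉ Up T g := by
    rw [ae_all_iff]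
    intro n
    have := (hT.iterate n).measure_preimage (Up_meas hT.measurable hgm).nullMeasurableSet
    rw [h0'] at this
    exact measure_eq_zero_iff_ae_notMem.1 this
  obtain ⟨ω, h1, h2⟩ := (h.and hnot).exists
  have hfin : {n | birkhoffSum T g n ω ≤ 0}.Finite := by
    have := h1.eventually (eventually_gt_atTop 0)
    rw [← Nat.cofinite_eq_atTop] at this
    refine (Filter.eventually_cofinite.1 this).subset ?_
    intro n hn
    simpa using hn
  obtain ⟨n, hn, hmax⟩ := hfin.exists_maximal ⟨0, by simp⟩
  apply h2 n
  intro k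
  have hadd := birkhoffSum_add T g n (k + 1) ω
  have : ¬ birkhoffSum T g (n + (k + 1)) ω ≤ 0 := by
    intro hle
    have := hmax hle (by omega)
    omega
  simp at hn
  omega

/-- Positive drift and ergodicity force transience to `+∞`. -/
lemma tendsto_of_drift_pos (hT : Ergodic T μ) {g : Ω → ℤ} (hgm : Measurable g)
    (hg : ∀ ω, -1 ≤ g ω ∧ g ω ≤ 1) (hpos : 0 < ∫ ω, (g ω : ℝ) ∂μ) :
    ∀ᵐ ω ∂μ, Tendsto (fun n => birkhoffSum T g n ω) atTop atTop := by
  have hTm := hT.toMeasurePreserving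
  have hUm := Up_meas hT.measurable hgm
  have hU : 0 < μ.real (Up T g) := by
    refine lt_of_lt_of_le hpos (ge_of_tendsto' (tendsto_posn hTm hgm hg) fun n => ?_)
    rw [integral_g_eq hTm hgm hg n]
    have : ∫ ω, ((rmin T g (n + 1) ω - rmin T g n ω : ℤ) : ℝ) ∂μ ≤ 0 := by
      refine integral_nonpos fun ω => ?_
      have := rmin_succ_le (T := T) g n ω
      show ((rmin T g (n + 1) ω - rmin T g n ω : ℤ) : ℝ) ≤ 0
      exact_mod_cast (by omega : rmin T g (n + 1) ω - rmin T g n ω ≤ 0)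
    linarith
  set F : Set Ω := {ω | ∃ᶠ n in atTop, T^[n] ω ∈ Up T g} with hF
  have hFm : MeasurableSet F := by
    have : F = limsup (fun n => (T^[n]) ⁻¹' (Up T g)) atTop := by
      ext ω
      rw [mem_limsup_iff_frequently_mem]
      rfl
    rw [this]
    exact MeasurableSet.measurableSet_limsup fun n => (hT.measurable.iterate n) hUm
  have hinv : T ⁻¹' F = F := by
    ext ω
    have e : ∀ n, T^[n] (T ω) = T^[n + 1] ω := fun n => (Function.iterate_succ_apply T n ω).symm
    simp only [hF, Set.mem_preimage, Set.mem_ofPred_eq, e]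
    conv_rhs => rw [← map_add_atTop_eq_nat 1, frequently_map]
  have hrec := hTm.conservative.ae_mem_imp_frequently_image_mem hUm.nullMeasurableSet
  have hae : ∀ᵐ ω ∂μ, ω ∈ F := by
    rcases hT.toPreErgodic.ae_mem_or_ae_notMem hFm hinv with h | h
    · exact h
    · exfalso
      have : μ (Up T g) = 0 := by
        rw [measure_eq_zero_iff_ae_notMem]
        filter_upwards [h, hrec] with ω h1 h2 h3
        exact h1 (h2 h3)
      rw [Measure.real, this] at hU
      simp at hU
  filter_upwards [hae] with ω hω
  have hstep : ∀ n, T^[n] ω ∈ Up T g → ∀ k > n, birkhoffSum T g n ω + 1 ≤ birkhoffSum T g k ω := by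
    intro n hn k hk
    obtain ⟨d, rfl⟩ : ∃ d, k = n + (d + 1) := ⟨k - n - 1, by omega⟩
    rw [birkhoffSum_add]
    have := hn d
    omega
  have hω' : ∀ a, ∃ n ≥ a, T^[n] ω ∈ Up T g := frequently_atTop.1 hω
  obtain ⟨n0, -, hn0⟩ := hω' 0
  have key : ∀ c : ℕ, ∃ n, ∀ k > n, birkhoffSum T g n0 ω + c ≤ birkhoffSum T g k ω := by
    intro c
    induction c with
    | zero =>
      refine ⟨n0, fun k hk => ?_⟩
      have := hstep n0 hn0 k hk
      simp; omega
    | succ c ih =>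
      obtain ⟨n, hn⟩ := ih
      obtain ⟨n', h1, h2⟩ := hω' (n + 1)
      refine ⟨n', fun k hk => ?_⟩
      have := hn n' (by omega)
      have := hstep n' h2 k hk
      push_cast; omega
  rw [tendsto_atTop]
  intro b
  obtain ⟨n, hn⟩ := key (b - birkhoffSum T g n0 ω).toNat
  filter_upwards [eventually_gt_atTop n] with k hk
  have := hn k hk
  omega

end Erg
end DMP

open MeasureTheory Topology Filter
open scoped ENNReal NNReal
namespace DMP
set_option linter.unusedSectionVars false

/-! ### Twisted Bernoulli shifts -/

section Tw
variable {E : Type*} [MeasurableSpace E] {κ : Measure E} [IsProbabilityMeasure κ] {φ : E → E}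

/-- twisted shift -/
def tsh (φ : E → E) (ω : ℤ → E) : ℤ → E := fun i => φ (ω (i + 1))

lemma tsh_iter (φ : E → E) (n : ℕ) (ω : ℤ → E) (i : ℤ) :
    ((tsh φ)^[n] ω) i = φ^[n] (ω (i + n)) := by
  induction n generalizing ω i with
  | zero => simp
  | succ n ih =>
    rw [Function.iterate_succ_apply, ih, Function.iterate_succ_apply]
    simp only [tsh]
    push_cast
    ring_nf

lemma tsh_meas (hφ : Measurable φ) : Measurable (tsh φ) := by
  unfold tsh
  fun_prop

lemma box_pre (φ : E → E) (n : ℕ) (s : Finset ℤ) (t : ℤ → Set E) :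
    ((tsh φ)^[n]) ⁻¹' ((s : Set ℤ).pi t) =
      ((s.image (fun i => i + (n : ℤ)) : Finset ℤ) : Set ℤ).pi (fun i => φ^[n] ⁻¹' t (i - n)) := by
  ext ω
  simp only [Set.mem_preimage, Set.mem_pi, tsh_iter, Finset.coe_image, Set.mem_image,
    forall_exists_index, and_imp]
  constructor
  · rintro h i j hj rfl
    simpa using h j hj
  · intro h j hj
    simpa using h _ j hj rfl

lemma box_meas (hφ : MeasurePreserving φ κ κ) (n : ℕ) (s : Finset ℤ) (t : ℤ → Set E)
    (ht : ∀ i, MeasurableSet (t i)) :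
    Measure.infinitePi (fun _ : ℤ => κ) (((tsh φ)^[n]) ⁻¹' ((s : Set ℤ).pi t)) =
      ∏ i ∈ s, κ (t i) := by
  rw [box_pre, Measure.infinitePi_pi]
  · rw [Finset.prod_image (by intro a _ b _ h; simpa using h)]
    refine Finset.prod_congr rfl fun i _ => ?_
    rw [add_sub_cancel_right, (hφ.iterate n).measure_preimage (ht _).nullMeasurableSet]
  · intro i _
    exact (hφ.iterate n).measurable (ht _)

lemma tsh_mp (hφ : MeasurePreserving φ κ κ) :
    MeasurePreserving (tsh φ) (Measure.infinitePi (fun _ : ℤ => κ))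
      (Measure.infinitePi (fun _ : ℤ => κ)) := by
  refine ⟨tsh_meas hφ.measurable, ?_⟩
  refine Measure.eq_infinitePi _ fun s t ht => ?_
  rw [Measure.map_apply (tsh_meas hφ.measurable)
    (MeasurableSet.pi (Finset.countable_toSet _) fun i _ => ht i)]
  exact box_meas hφ 1 s t ht

lemma box_indep (hφ : MeasurePreserving φ κ κ) {A B : Set (ℤ → E)}
    (hA : A ∈ squareCylinders fun _ : ℤ => {s : Set E | MeasurableSet s})
    (hB : B ∈ squareCylinders fun _ : ℤ => {s : Set E | MeasurableSet s}) :
    ∀ᶠ n : ℕ in atTop, Measure.infinitePi (fun _ : ℤ => κ) (((tsh φ)^[n]) ⁻¹' A ∩ B) =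
      Measure.infinitePi (fun _ : ℤ => κ) A * Measure.infinitePi (fun _ : ℤ => κ) B := by
  classical
  obtain ⟨s, t, ht, rfl⟩ := hA
  obtain ⟨s', t', ht', rfl⟩ := hB
  have ht : ∀ i, MeasurableSet (t i) := fun i => ht i trivial
  have ht' : ∀ i, MeasurableSet (t' i) := fun i => ht' i trivial
  have hev : ∀ᶠ n : ℕ in atTop, Disjoint (s.image (fun i => i + (n : ℤ))) s' := by
    obtain ⟨a, ha⟩ := s.bddBelow
    obtain ⟨b, hb⟩ := s'.bddAbove
    filter_upwards [eventually_gt_atTop (b - a).toNat] with n hn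
    rw [Finset.disjoint_left]
    rintro i hi hi'
    obtain ⟨j, hj, rfl⟩ := Finset.mem_image.1 hi
    have h1 := ha hj
    have h2 := hb hi'
    omega
  filter_upwards [hev] with n hn
  have key : ((tsh φ)^[n]) ⁻¹' ((s : Set ℤ).pi t) ∩ (s' : Set ℤ).pi t' =
      ((s.image (fun i => i + (n : ℤ)) ∪ s' : Finset ℤ) : Set ℤ).pi
        (fun i => if i ∈ s' then t' i else φ^[n] ⁻¹' t (i - n)) := by
    rw [box_pre]
    ext ω
    simp only [Set.mem_inter_iff, Set.mem_pi, Finset.mem_coe, Finset.mem_union]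
    constructor
    · rintro ⟨h1, h2⟩ i hi
      by_cases h : i ∈ s'
      · simpa [h] using h2 i h
      · simpa [h] using h1 i (hi.resolve_right h)
    · intro h
      refine ⟨fun i hi => ?_, fun i hi => ?_⟩
      · have := h i (Or.inl hi)
        rwa [if_neg (Finset.disjoint_left.1 hn hi)] at this
      · have := h i (Or.inr hi)
        rwa [if_pos hi] at this
  rw [key, Measure.infinitePi_pi, Finset.prod_union hn, Measure.infinitePi_pi _ fun i _ => ht i,
    Measure.infinitePi_pi _ fun i _ => ht' i]
  · congr 1
    · rw [Finset.prod_image (by intro a _ b _ h; simpa using h)]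
      refine Finset.prod_congr rfl fun i hi => ?_
      rw [if_neg (Finset.disjoint_left.1 hn (Finset.mem_image_of_mem _ hi)),
        add_sub_cancel_right, (hφ.iterate n).measure_preimage (ht _).nullMeasurableSet]
    · refine Finset.prod_congr rfl fun i hi => ?_
      rw [if_pos hi]
  · intro i _
    split_ifs
    · exact ht' i
    · exact (hφ.iterate n).measurable (ht _)

lemma prod_tsh_ergodic {E' : Type*} [MeasurableSpace E'] {κ' : Measure E'}
    [IsProbabilityMeasure κ'] {φ' : E' → E'} (hφ : MeasurePreserving φ κ κ)
    (hφ' : MeasurePreserving φ' κ' κ') :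
    Ergodic (Prod.map (tsh φ) (tsh φ')) ((Measure.infinitePi (fun _ : ℤ => κ)).prod
      (Measure.infinitePi (fun _ : ℤ => κ'))) := by
  have hpi : ∀ (F : Type _) [MeasurableSpace F],
      IsPiSystem (squareCylinders fun _ : ℤ => {s : Set F | MeasurableSet s}) := fun F _ =>
    isPiSystem_squareCylinders (fun _ => MeasurableSpace.isPiSystem_measurableSet) (by simp)
  have hpi' : ∀ (F : Type _) [MeasurableSpace F],
      IsPiSystem (squareCylinders fun _ : ℤ => {s : Set F | MeasurableSet s}) := fun F _ =>
    isPiSystem_squareCylinders (fun _ => MeasurableSpace.isPiSystem_measurableSet) (by simp)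
  refine ergodic_of_piSystem ((tsh_mp hφ).prod (tsh_mp hφ'))
    (Set.image2 (· ×ˢ ·) (squareCylinders fun _ : ℤ => {s : Set E | MeasurableSet s})
      (squareCylinders fun _ : ℤ => {s : Set E' | MeasurableSet s}))
    ((hpi E).prod (hpi' E')) ?_ ?_
  · symm
    refine generateFrom_eq_prod generateFrom_squareCylinders generateFrom_squareCylinders
      ⟨fun _ => Set.univ, fun _ => ⟨∅, fun _ => Set.univ, by simp, by simp⟩, Set.iUnion_const _⟩
      ⟨fun _ => Set.univ, fun _ => ⟨∅, fun _ => Set.univ, by simp, by simp⟩, Set.iUnion_const _⟩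
  · rintro _ ⟨A, hA, A', hA', rfl⟩ _ ⟨B, hB, B', hB', rfl⟩
    filter_upwards [box_indep hφ hA hB, box_indep hφ' hA' hB'] with n h1 h2
    rw [Prod.map_iterate, show Prod.map (tsh φ)^[n] (tsh φ')^[n] ⁻¹' (A ×ˢ A') =
      ((tsh φ)^[n] ⁻¹' A) ×ˢ ((tsh φ')^[n] ⁻¹' A') from rfl, Set.prod_inter_prod]
    rw [Measure.prod_prod, Measure.prod_prod, Measure.prod_prod, h1, h2]
    ring

end Tw
end DMP

open MeasureTheory Topology Filter
open scoped ENNReal NNReal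
namespace DMP
set_option linter.unusedSectionVars false

/-! ### Measurability and drift on the Dyck-Motzkin shift -/

variable {M N : ℕ}

instance : MeasurableSingletonClass (DMSym M N) := ⟨fun _ => trivial⟩

lemma meas_G (j : ℤ) : Measurable (fun y : ℤ → DMSym M N => Gfun y j) := by
  have h : Measurable (fun s : DMSym M N => (match s with
    | .la _ => (1 : ℤ)
    | .u _ => 0
    | .ra _ => -1)) := measurable_from_top
  exact h.comp (measurable_pi_apply j)

lemma meas_H (j : ℤ) : Measurable (fun y : ℤ → DMSym M N => Hfun y j) := by
  unfold Hfun
  by_cases h : 0 ≤ j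
  · simp only [h, if_true]
    exact Finset.measurable_fun_sum _ fun k _ => meas_G _
  · simp only [h, if_false]
    exact (Finset.measurable_fun_sum _ fun k _ => meas_G _).neg

lemma meas_matched (i j : ℤ) : MeasurableSet {y : ℤ → DMSym M N | Matched y i j} := by
  unfold Matched
  refine MeasurableSet.inter (MeasurableSet.const _) (MeasurableSet.inter ?_ ?_)
  · exact measurableSet_eq_fun (meas_H _) (meas_H _)
  · have h : MeasurableSet {y : ℤ → DMSym M N | ∀ l, i < l → l ≤ j → Hfun y i < Hfun y l} := by
      simp only [Set.ofPred_forall]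
      refine MeasurableSet.iInter fun l => MeasurableSet.iInter fun _ =>
        MeasurableSet.iInter fun _ => ?_
      exact measurableSet_lt (meas_H _) (meas_H _)
    exact h

lemma meas_coord (j : ℤ) (a : DMSym M N) : MeasurableSet {y : ℤ → DMSym M N | y j = a} :=
  measurable_pi_apply (X := fun _ : ℤ => DMSym M N) j (measurableSet_singleton a)

lemma meas_dec : Measurable (dec : (ℤ → DMSym M N) → (ℤ → DMSym M N)) := by
  refine measurable_pi_lambda _ fun j => measurable_to_countable' fun a => ?_
  have hs : (fun y : ℤ → DMSym M N => dec y j) ⁻¹' {a} = {y | dec y j = a} := rfl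
  rw [hs]
  rcases a with k | k | k
  · simp only [dec_la_iff]; exact meas_coord _ _
  · simp only [dec_u_iff]; exact meas_coord _ _
  · simp only [dec_ra_iff]
    have hE : MeasurableSet {y : ℤ → DMSym M N | ∃ i, Matched y i j} := by
      simp only [Set.ofPred_exists]
      exact MeasurableSet.iUnion fun i => meas_matched i j
    refine MeasurableSet.inter ?_ (MeasurableSet.union ?_ (MeasurableSet.inter hE.compl (meas_coord _ _)))
    · have h : MeasurableSet {y : ℤ → DMSym M N | ∃ k, y j = .ra k} := by
        simp only [Set.ofPred_exists]
        exact MeasurableSet.iUnion fun i => meas_coord _ _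
      exact h
    · have h : MeasurableSet {y : ℤ → DMSym M N | ∃ i, Matched y i j ∧ y i = .la k} := by
        simp only [Set.ofPred_exists]
        exact MeasurableSet.iUnion fun i => (meas_matched i j).inter (meas_coord _ _)
      exact h

/-- retraction onto the shift space -/
noncomputable def decX (y : ℤ → DMSym M N) : ↥(SigmaD M N) := ⟨dec y, dec_mem y⟩

lemma meas_decX : Measurable (decX : (ℤ → DMSym M N) → ↥(SigmaD M N)) :=
  meas_dec.subtype_mk

lemma decX_val (x : ↥(SigmaD M N)) : decX x.1 = x := Subtype.ext (dec_eq_self x.2)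

lemma decX_shift (y : ℤ → DMSym M N) : decX (shift y) = shiftD M N (decX y) :=
  Subtype.ext (dec_shift y)

lemma shiftInv_mem {x : ℤ → DMSym M N} (hx : x ∈ SigmaD M N) : shiftInv x ∈ SigmaD M N := by
  intro j k hjk
  have h := wordAt_shift (shiftInv x) (j - 1) (k - 1)
  have h2 : shift (shiftInv x) = x := by funext i; simp [shift, shiftInv]
  rw [h2, sub_add_cancel, sub_add_cancel] at h
  rw [← h]
  exact hx _ _ (by omega)

lemma meas_shift : Measurable (shift : (ℤ → DMSym M N) → (ℤ → DMSym M N)) :=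
  measurable_pi_lambda _ fun _ => measurable_pi_apply _

lemma meas_shiftInv : Measurable (shiftInv : (ℤ → DMSym M N) → (ℤ → DMSym M N)) :=
  measurable_pi_lambda _ fun _ => measurable_pi_apply _

/-- The shift as a measurable equivalence. -/
def shiftE (M N : ℕ) : ↥(SigmaD M N) ≃ᵐ ↥(SigmaD M N) where
  toFun := shiftD M N
  invFun x := ⟨shiftInv x.1, shiftInv_mem x.2⟩
  left_inv x := Subtype.ext (by funext i; simp [shift, shiftInv, shiftD])
  right_inv x := Subtype.ext (by funext i; simp [shift, shiftInv, shiftD])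
  measurable_toFun := (meas_shift.comp measurable_subtype_coe).subtype_mk
  measurable_invFun := (meas_shiftInv.comp measurable_subtype_coe).subtype_mk

lemma meas_shiftD : Measurable (shiftD M N) := (shiftE M N).measurable

/-- going up -/
def Asc (x : ℤ → DMSym M N) : Prop := Tendsto (Hfun x) atTop atTop ∧ Tendsto (Hfun x) atBot atBot

lemma meas_Asc : MeasurableSet {x : ℤ → DMSym M N | Asc x} :=
  (measurableSet_tendsto (f := fun i (x : ℤ → DMSym M N) => Hfun x i) atTop meas_H).inter
    (measurableSet_tendsto (f := fun i (x : ℤ → DMSym M N) => Hfun x i) atBot meas_H)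

lemma ae_Asc_iff {μ : Measure ↥(SigmaD M N)} [IsProbabilityMeasure μ] :
    μ (Subtype.val ⁻¹' AalphaSet M N) = 1 ↔ ∀ᵐ x ∂μ, Asc x.1 := by
  have h : (Subtype.val ⁻¹' AalphaSet M N : Set ↥(SigmaD M N)) = {x | Asc x.1} := by
    ext x
    simp [AalphaSet, Asc]
  rw [h]
  exact (prob_compl_eq_zero_iff (measurable_subtype_coe meas_Asc)).symm

lemma shiftD_iter (n : ℕ) (x : ↥(SigmaD M N)) (i : ℤ) :
    ((shiftD M N)^[n] x).1 i = x.1 (i + n) := by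
  induction n generalizing x with
  | zero => simp
  | succ n ih =>
    rw [Function.iterate_succ_apply, ih]
    simp only [shiftD, shift]
    push_cast
    ring_nf

lemma shiftE_symm_iter (n : ℕ) (x : ↥(SigmaD M N)) (i : ℤ) :
    (((shiftE M N).symm)^[n] x).1 i = x.1 (i - n) := by
  induction n generalizing x with
  | zero => simp
  | succ n ih =>
    rw [Function.iterate_succ_apply, ih]
    change x.1 (i - n - 1) = _
    push_cast
    ring_nf

lemma bs_eq (n : ℕ) (x : ↥(SigmaD M N)) :
    birkhoffSum (shiftD M N) (fun x => Gfun x.1 0) n x = Hfun x.1 n := by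
  induction n with
  | zero => simp [H_zero]
  | succ n ih =>
    rw [birkhoffSum_succ, ih, Nat.cast_succ, H_succ]
    congr 1
    simp only [Gfun, shiftD_iter, zero_add]

lemma bs_symm_eq (n : ℕ) (x : ↥(SigmaD M N)) :
    birkhoffSum ((shiftE M N).symm) (fun x => Gfun x.1 (-1)) n x = - Hfun x.1 (-n) := by
  induction n with
  | zero => simp [H_zero]
  | succ n ih =>
    rw [birkhoffSum_succ, ih]
    have := H_succ x.1 (-(n : ℤ) - 1)
    rw [sub_add_cancel] at this
    rw [this, show (-((n + 1 : ℕ) : ℤ)) = -(n : ℤ) - 1 by push_cast; ring]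
    have h2 : Gfun (((shiftE M N).symm)^[n] x).1 (-1) = Gfun x.1 (-(n : ℤ) - 1) := by
      simp only [Gfun, shiftE_symm_iter]
      ring_nf
    rw [h2]
    ring

lemma tendsto_int_nat {f : ℤ → ℤ} (h : Tendsto (fun n : ℕ => f n) atTop atTop) :
    Tendsto f atTop atTop := by
  rw [tendsto_atTop] at h ⊢
  intro b
  obtain ⟨n, hn⟩ := eventually_atTop.1 (h b)
  refine eventually_atTop.2 ⟨n, fun i hi => ?_⟩
  have := hn i.toNat (by omega)
  rwa [Int.toNat_of_nonneg (by omega)] at this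

/-- mean drift -/
noncomputable def drift (μ : Measure ↥(SigmaD M N)) : ℝ := ∫ x, (Gfun x.1 0 : ℝ) ∂μ

lemma meas_GX (j : ℤ) : Measurable (fun x : ↥(SigmaD M N) => Gfun x.1 j) :=
  (meas_G j).comp measurable_subtype_coe

lemma drift_pos_of_Asc {μ : Measure ↥(SigmaD M N)} [IsProbabilityMeasure μ]
    (hT : MeasurePreserving (shiftD M N) μ μ) (h : ∀ᵐ x ∂μ, Asc x.1) : 0 < drift μ := by
  refine drift_pos hT (meas_GX 0) (fun x => G_bd _ _) ?_
  filter_upwards [h] with x hx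
  simp only [bs_eq]
  exact hx.1.comp tendsto_natCast_atTop_atTop

lemma Asc_of_drift_pos {μ : Measure ↥(SigmaD M N)} [IsProbabilityMeasure μ]
    (hT : Ergodic (shiftD M N) μ) (h : 0 < drift μ) : ∀ᵐ x ∂μ, Asc x.1 := by
  have h1 := tendsto_of_drift_pos hT (meas_GX 0) (fun x => G_bd _ _) h
  have hT' : Ergodic ((shiftE M N).symm) μ := Ergodic.symm (e := shiftE M N) hT
  have h2 := tendsto_of_drift_pos hT' (meas_GX (-1)) (fun x => G_bd _ _) (by
    have he := hT'.toMeasurePreserving.integral_comp' (g := fun x => (Gfun x.1 0 : ℝ))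
    unfold drift at h
    rw [← he] at h
    exact h)
  filter_upwards [h1, h2] with x hx1 hx2
  simp only [bs_eq] at hx1
  simp only [bs_symm_eq] at hx2
  refine ⟨tendsto_int_nat hx1, ?_⟩
  have h3 : Tendsto (fun i : ℤ => - Hfun x.1 (-i)) atTop atTop := tendsto_int_nat hx2
  have h4 := tendsto_neg_atTop_atBot.comp (h3.comp tendsto_neg_atBot_atTop)
  refine h4.congr fun i => ?_
  simp

end DMP

open MeasureTheory Topology Filter
open scoped ENNReal NNReal
namespace DMP
set_option linter.unusedSectionVars false

/-! ### Renewal construction -/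

/-- uniform measure on the unit interval -/
noncomputable def unif : Measure ℝ := volume.restrict (Set.Icc 0 1)

instance : IsProbabilityMeasure unif := ⟨by simp [unif]⟩
instance : NullSingletonClass unif := by unfold unif; infer_instance

lemma unif_Ici_lt {ε : ℝ} (hε : 0 < ε) : unif (Set.Ici ε) < 1 := by
  rw [unif, Measure.restrict_apply measurableSet_Ici]
  calc volume (Set.Ici ε ∩ Set.Icc 0 1) ≤ volume (Set.Icc ε 1) :=
        measure_mono fun x hx => ⟨hx.1, hx.2.2⟩
    _ = ENNReal.ofReal (1 - ε) := Real.volume_Icc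
    _ < 1 := by rw [ENNReal.ofReal_lt_one]; linarith

/-- law of the renewal clock -/
noncomputable def Pc : Measure (ℤ → ℝ) := Measure.infinitePi (fun _ : ℤ => unif)

instance : IsProbabilityMeasure Pc := by unfold Pc; infer_instance

lemma tau_ex (ε : ℝ) (c : ℤ → ℝ) (j : ℤ) :
    ∃ n : ℕ, c (j - n) < ε ∨ ∀ m : ℕ, ¬ c (j - m) < ε := by
  by_cases h : ∃ n : ℕ, c (j - n) < ε
  · obtain ⟨n, hn⟩ := h
    exact ⟨n, Or.inl hn⟩
  · exact ⟨0, Or.inr fun m hm => h ⟨m, hm⟩⟩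

open Classical in
/-- last renewal before `j` -/
noncomputable def tau (ε : ℝ) (c : ℤ → ℝ) (j : ℤ) : ℤ := j - (Nat.find (tau_ex ε c j) : ℕ)

/-- there are always earlier renewals -/
def Good (ε : ℝ) (c : ℤ → ℝ) : Prop := ∀ j : ℤ, ∃ n : ℕ, c (j - n) < ε

/-- no renewal between `0` and `j` -/
def NoRen (ε : ℝ) (c : ℤ → ℝ) (j : ℤ) : Prop := ∀ l, min 0 j < l → l ≤ max 0 j → ε ≤ c l

lemma tau_le (ε : ℝ) (c : ℤ → ℝ) (j : ℤ) : tau ε c j ≤ j := by unfold tau; omega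

lemma tau_spec' {ε : ℝ} {c : ℤ → ℝ} {j : ℤ} (h : ∃ n : ℕ, c (j - n) < ε) :
    c (tau ε c j) < ε ∧ ∀ l, tau ε c j < l → l ≤ j → ε ≤ c l := by
  classical
  have h1 := Nat.find_spec (tau_ex ε c j)
  constructor
  · rcases h1 with h1 | h1
    · unfold tau; convert h1
    · obtain ⟨n, hn⟩ := h
      exact absurd hn (h1 n)
  · intro l hl hlj
    have hlt : (j - l).toNat < Nat.find (tau_ex ε c j) := by
      have : tau ε c j = j - (Nat.find (tau_ex ε c j) : ℕ) := by unfold tau; congr!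
      omega
    have h2 := Nat.find_min (tau_ex ε c j) hlt
    push Not at h2
    have h3 := h2.1
    rwa [Int.toNat_of_nonneg (by omega), sub_sub_cancel] at h3

lemma tau_unique {ε : ℝ} {c : ℤ → ℝ} {i j : ℤ} (hij : i ≤ j) (hi : c i < ε)
    (h : ∀ l, i < l → l ≤ j → ε ≤ c l) : tau ε c j = i := by
  obtain ⟨h1, h2⟩ := tau_spec' (ε := ε) (c := c) (j := j) ⟨(j - i).toNat, by
    rwa [Int.toNat_of_nonneg (by omega), sub_sub_cancel]⟩
  have h3 := tau_le ε c j
  rcases lt_trichotomy (tau ε c j) i with h4 | h4 | h4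
  · exact absurd hi (not_lt.2 (h2 i h4 hij))
  · exact h4
  · exact absurd h1 (not_lt.2 (h _ h4 h3))

lemma tau_eq_iff {ε : ℝ} {c : ℤ → ℝ} (hG : Good ε c) (j : ℤ) :
    tau ε c j = tau ε c 0 ↔ NoRen ε c j := by
  obtain ⟨h1, h2⟩ := tau_spec' (hG j)
  obtain ⟨h3, h4⟩ := tau_spec' (hG 0)
  have h5 := tau_le ε c j
  have h6 := tau_le ε c 0
  constructor
  · intro h l hl hl'
    rcases le_total 0 j with hj | hj
    · exact h2 l (by omega) (by omega)
    · exact h4 l (by omega) (by omega)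
  · intro h
    rcases le_total 0 j with hj | hj
    · refine tau_unique (by omega) h3 fun l hl hl' => ?_
      rcases le_total l 0 with h0 | h0
      · exact h4 l hl h0
      · rcases eq_or_lt_of_le h0 with h7 | h7
        · exact h4 l hl (by omega)
        · exact h l (by omega) (by omega)
    · symm
      refine tau_unique (by omega) h1 fun l hl hl' => ?_
      rcases le_or_gt l j with h0 | h0
      · exact h2 l hl h0
      · exact h l (by omega) (by omega)

lemma tau_shift {ε : ℝ} {c : ℤ → ℝ} (j : ℤ) :
    tau ε (tsh id c) j = tau ε c (j + 1) - 1 := by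
  classical
  have : Nat.find (tau_ex ε (tsh id c) j) = Nat.find (tau_ex ε c (j + 1)) := by
    refine Nat.find_congr' fun {n} => ?_
    have h : ∀ n : ℕ, tsh id c (j - n) = c (j + 1 - n) := fun n => by
      simp only [tsh, id]; congr 1; ring
    simp only [h]
  have h1 : ∀ c j, tau ε c j = j - (Nat.find (tau_ex ε c j) : ℕ) := fun c j => by
    unfold tau; congr!
  rw [h1, h1, this]
  ring

lemma meas_tau (ε : ℝ) (j : ℤ) : Measurable (fun c : ℤ → ℝ => tau ε c j) := by
  classical
  have hlt : ∀ i : ℤ, MeasurableSet {c : ℤ → ℝ | c i < ε} := fun i =>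
    measurableSet_lt (measurable_pi_apply i) measurable_const
  have h := measurable_find (p := fun (c : ℤ → ℝ) (n : ℕ) =>
    c (j - n) < ε ∨ ∀ m : ℕ, ¬ c (j - m) < ε) (fun c => tau_ex ε c j) (fun k => by
      refine MeasurableSet.union (hlt _) ?_
      have : MeasurableSet {c : ℤ → ℝ | ∀ m : ℕ, ¬ c (j - m) < ε} := by
        simp only [Set.ofPred_forall]
        exact MeasurableSet.iInter fun m => (hlt _).compl
      exact this)
  have h2 : Measurable (fun n : ℕ => j - (n : ℤ)) := measurable_from_top
  have h3 := h2.comp h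
  unfold tau
  convert h3 using 2
  simp only [Function.comp]

lemma meas_NoRen (ε : ℝ) (j : ℤ) : MeasurableSet {c : ℤ → ℝ | NoRen ε c j} := by
  simp only [NoRen, Set.ofPred_forall]
  refine MeasurableSet.iInter fun l => MeasurableSet.iInter fun _ => MeasurableSet.iInter fun _ => ?_
  exact measurableSet_le measurable_const (measurable_pi_apply l)

lemma ae_Good {ε : ℝ} (hε : 0 < ε) : ∀ᵐ c ∂Pc, Good ε c := by
  unfold Good
  rw [ae_all_iff]
  intro j
  have h0 : ∀ n : ℕ, Pc {c | ¬ ∃ n : ℕ, c (j - n) < ε} ≤ (unif (Set.Ici ε)) ^ n := by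
    intro n
    calc Pc {c | ¬ ∃ n : ℕ, c (j - n) < ε}
        ≤ Pc (((Finset.range n).image (fun k : ℕ => j - (k : ℤ)) : Set ℤ).pi
            fun _ => Set.Ici ε) := by
          refine measure_mono fun c hc => ?_
          simp only [Set.mem_ofPred_eq, not_exists, not_lt] at hc
          intro i hi
          obtain ⟨k, _, rfl⟩ := Finset.mem_image.1 (Finset.mem_coe.1 hi)
          exact hc k
      _ = (unif (Set.Ici ε)) ^ n := by
          rw [Pc, Measure.infinitePi_pi _ fun i _ => measurableSet_Ici]
          rw [Finset.prod_const, Finset.card_image_of_injective, Finset.card_range]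
          intro a b hab
          simpa using hab
  have h1 := ENNReal.tendsto_pow_atTop_nhds_zero_of_lt_one (unif_Ici_lt hε)
  exact le_antisymm (ge_of_tendsto' h1 h0) zero_le

section Upd
variable {E : Type*} [MeasurableSpace E] (κ : Measure E) [IsProbabilityMeasure κ]

/-- i.i.d. blocks -/
noncomputable def PK : Measure (ℤ → E) := Measure.infinitePi (fun _ : ℤ => κ)

instance : IsProbabilityMeasure (PK κ) := by unfold PK; infer_instance

lemma map_update (i : ℤ) :
    Measure.map (fun p : (ℤ → E) × E => Function.update p.1 i p.2) ((PK κ).prod κ) = PK κ := by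
  classical
  have hm : Measurable (fun p : (ℤ → E) × E => Function.update p.1 i p.2) := by
    refine measurable_pi_lambda _ fun j => ?_
    by_cases h : j = i
    · subst h; simpa using measurable_snd
    · simp only [Function.update_of_ne h]; fun_prop
  refine Measure.eq_infinitePi _ fun s t ht => ?_
  rw [Measure.map_apply hm (MeasurableSet.pi (Finset.countable_toSet _) fun i _ => ht i)]
  by_cases hi : i ∈ s
  · have : (fun p : (ℤ → E) × E => Function.update p.1 i p.2) ⁻¹' ((s : Set ℤ).pi t) =
        (((s.erase i : Finset ℤ) : Set ℤ).pi t) ×ˢ (t i) := by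
      ext ⟨K, k⟩
      simp only [Set.mem_preimage, Set.mem_pi, Set.mem_prod, Finset.mem_coe, Finset.mem_erase]
      constructor
      · intro h
        refine ⟨fun j hj => ?_, by simpa using h i hi⟩
        simpa [hj.1] using h j hj.2
      · rintro ⟨h1, h2⟩ j hj
        by_cases hji : j = i
        · subst hji; simpa using h2
        · simpa [hji] using h1 j ⟨hji, hj⟩
    rw [this, Measure.prod_prod, PK, Measure.infinitePi_pi _ fun i _ => ht i,
      Finset.prod_erase_mul _ _ hi]
  · have : (fun p : (ℤ → E) × E => Function.update p.1 i p.2) ⁻¹' ((s : Set ℤ).pi t) =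
        ((s : Set ℤ).pi t) ×ˢ Set.univ := by
      ext ⟨K, k⟩
      simp only [Set.mem_preimage, Set.mem_pi, Set.mem_prod, Finset.mem_coe, Set.mem_univ, and_true]
      refine forall₂_congr fun j hj => ?_
      have : j ≠ i := fun h => hi (h ▸ hj)
      simp [this]
    rw [this, Measure.prod_prod, PK, Measure.infinitePi_pi _ fun i _ => ht i, measure_univ, mul_one]

lemma upd_mp (ε : ℝ) : MeasurePreserving
    (fun p : (ℤ → ℝ) × ((ℤ → E) × E) => (p.1, Function.update p.2.1 (tau ε p.1 0) p.2.2))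
    (Pc.prod ((PK κ).prod κ)) (Pc.prod (PK κ)) := by
  refine (MeasurePreserving.id Pc).skew_product
    (g := fun (c : ℤ → ℝ) (q : (ℤ → E) × E) => Function.update q.1 (tau ε c 0) q.2) ?_ ?_
  · refine measurable_pi_lambda _ fun j => ?_
    have : (fun p : (ℤ → ℝ) × ((ℤ → E) × E) =>
        (Function.uncurry (fun (c : ℤ → ℝ) (q : (ℤ → E) × E) =>
          Function.update q.1 (tau ε c 0) q.2)) p j) =
        fun p => if j = tau ε p.1 0 then p.2.2 else p.2.1 j := by
      funext p
      simp only [Function.uncurry, Function.update_apply]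
    rw [this]
    refine Measurable.ite ?_ (by fun_prop) (by fun_prop)
    exact measurableSet_eq_fun measurable_const ((meas_tau ε 0).comp measurable_fst)
  · exact Eventually.of_forall fun c => map_update κ _

lemma meas_Ktau (ε : ℝ) (j : ℤ) :
    Measurable (fun p : (ℤ → ℝ) × (ℤ → E) => p.2 (tau ε p.1 j)) := by
  have h1 : Measurable (fun q : ℤ × (ℤ → E) => q.2 q.1) :=
    measurable_from_prod_countable_right fun i => measurable_pi_apply i
  exact h1.comp (((meas_tau ε j).comp measurable_fst).prodMk measurable_snd)

end Upd
end DMP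

open MeasureTheory Topology Filter
open scoped ENNReal NNReal
namespace DMP
set_option linter.unusedSectionVars false

/-! ### The interpolating family of measures -/

variable {M N : ℕ}

/-- block space -/
abbrev KX (M N : ℕ) := ℝ × (↥(SigmaD M N) × ↥(SigmaD M N))

/-- choose a block -/
noncomputable def sel (t : ℝ) (k : KX M N) : ↥(SigmaD M N) := if k.1 < t then k.2.1 else k.2.2

lemma meas_sel (t : ℝ) : Measurable (sel t : KX M N → ↥(SigmaD M N)) :=
  Measurable.ite (measurableSet_lt measurable_fst measurable_const) (by fun_prop) (by fun_prop)

/-- block dynamics -/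
def phi (M N : ℕ) : KX M N → KX M N := Prod.map id (Prod.map (shiftD M N) (shiftD M N))

lemma sel_phi (t : ℝ) (k : KX M N) : sel t (phi M N k) = shiftD M N (sel t k) := by
  unfold sel phi
  simp only [Prod.map_fst, Prod.map_snd, id]
  split_ifs <;> rfl

/-- concatenated sequence -/
noncomputable def zf (ε t : ℝ) (p : (ℤ → ℝ) × (ℤ → KX M N)) : ℤ → DMSym M N :=
  fun j => (sel t (p.2 (tau ε p.1 j))).1 j

open Classical in
/-- concatenated sequence, with the block at zero singled out -/
noncomputable def zp (ε t : ℝ) (p : (ℤ → ℝ) × ((ℤ → KX M N) × KX M N)) : ℤ → DMSym M N :=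
  fun j => (sel t (if NoRen ε p.1 j then p.2.2 else p.2.1 (tau ε p.1 j))).1 j

lemma zf_S (ε t : ℝ) (p : (ℤ → ℝ) × (ℤ → KX M N)) :
    zf ε t (Prod.map (tsh id) (tsh (phi M N)) p) = shift (zf ε t p) := by
  funext j
  simp only [zf, Prod.map_fst, Prod.map_snd, tau_shift, tsh, sel_phi, sub_add_cancel, shiftD, shift]

lemma meas_appl (j : ℤ) : Measurable (fun x : ↥(SigmaD M N) => x.1 j) :=
  (measurable_pi_apply j).comp measurable_subtype_coe

lemma meas_zf (ε t : ℝ) : Measurable (zf (M := M) (N := N) ε t) := by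
  refine measurable_pi_lambda _ fun j => ?_
  exact (meas_appl j).comp ((meas_sel t).comp (meas_Ktau ε j))

lemma meas_zp (ε t : ℝ) : Measurable (zp (M := M) (N := N) ε t) := by
  classical
  refine measurable_pi_lambda _ fun j => ?_
  refine (meas_appl j).comp ((meas_sel t).comp ?_)
  refine Measurable.ite (measurable_fst (meas_NoRen ε j)) (by fun_prop) ?_
  exact (meas_Ktau ε j).comp (measurable_fst.prodMk (measurable_fst.comp measurable_snd))

lemma zp_eq {ε : ℝ} (t : ℝ) {p : (ℤ → ℝ) × ((ℤ → KX M N) × KX M N)} (h : Good ε p.1) :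
    zp ε t p = zf ε t (p.1, Function.update p.2.1 (tau ε p.1 0) p.2.2) := by
  classical
  funext j
  simp only [zp, zf]
  rw [Function.update_apply]
  by_cases hj : NoRen ε p.1 j
  · rw [if_pos hj, if_pos ((tau_eq_iff h j).2 hj)]
  · rw [if_neg hj, if_neg (mt (tau_eq_iff h j).1 hj)]

lemma zp_of_NoRen {ε : ℝ} (t : ℝ) {p : (ℤ → ℝ) × ((ℤ → KX M N) × KX M N)}
    {j : ℤ} (h : NoRen ε p.1 j) : zp ε t p j = (sel t p.2.2).1 j := by
  simp only [zp, if_pos h]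

lemma zp_zero (ε t : ℝ) (p : (ℤ → ℝ) × ((ℤ → KX M N) × KX M N)) :
    zp ε t p 0 = (sel t p.2.2).1 0 :=
  zp_of_NoRen t fun l h1 h2 => by simp at h1 h2; omega

section Meas
variable (μ ν : Measure ↥(SigmaD M N)) [IsProbabilityMeasure μ] [IsProbabilityMeasure ν]

/-- block law -/
noncomputable def kap : Measure (KX M N) := unif.prod (μ.prod ν)

instance : IsProbabilityMeasure (kap μ ν) := by unfold kap; infer_instance

/-- base law -/
noncomputable def QQ : Measure ((ℤ → ℝ) × ((ℤ → KX M N) × KX M N)) :=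
  Pc.prod ((PK (kap μ ν)).prod (kap μ ν))

instance : IsProbabilityMeasure (QQ μ ν) := by unfold QQ; infer_instance

/-- the family -/
noncomputable def Phi (ε t : ℝ) : Measure ↥(SigmaD M N) :=
  Measure.map (fun p => decX (zp ε t p)) (QQ μ ν)

lemma meas_dz (ε t : ℝ) : Measurable (fun p : (ℤ → ℝ) × ((ℤ → KX M N) × KX M N) =>
    decX (zp ε t p)) := meas_decX.comp (meas_zp ε t)

instance (ε t : ℝ) : IsProbabilityMeasure (Phi μ ν ε t) :=
  Measure.isProbabilityMeasure_map (meas_dz ε t).aemeasurable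

lemma QQ_fst : MeasurePreserving Prod.fst (QQ μ ν) Pc := measurePreserving_fst

lemma QQ_snd : MeasurePreserving (fun p => p.2.2) (QQ μ ν) (kap μ ν) := by
  have h1 : MeasurePreserving Prod.snd (QQ μ ν) ((PK (kap μ ν)).prod (kap μ ν)) :=
    measurePreserving_snd
  have h2 : MeasurePreserving Prod.snd ((PK (kap μ ν)).prod (kap μ ν)) (kap μ ν) :=
    measurePreserving_snd
  exact h2.comp h1

lemma Phi_eq {ε : ℝ} (hε : 0 < ε) (t : ℝ) :
    Phi μ ν ε t = Measure.map (fun p => decX (zf ε t p)) (Pc.prod (PK (kap μ ν))) := by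
  have h1 : (fun p => decX (zp ε t p)) =ᵐ[QQ μ ν] (fun p => decX (zf ε t p)) ∘
      (fun p : (ℤ → ℝ) × ((ℤ → KX M N) × KX M N) =>
        (p.1, Function.update p.2.1 (tau ε p.1 0) p.2.2)) := by
    filter_upwards [(QQ_fst μ ν).quasiMeasurePreserving.ae (ae_Good hε)] with p hp
    simp only [Function.comp, zp_eq t hp]
  have hm : Measurable (fun p : (ℤ → ℝ) × (ℤ → KX M N) => decX (zf ε t p)) :=
    meas_decX.comp (meas_zf ε t)
  rw [Phi, Measure.map_congr h1, ← Measure.map_map hm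
    (upd_mp (kap μ ν) ε).measurable, QQ, (upd_mp (kap μ ν) ε).map_eq]

lemma Phi_ergodic (hμ : MeasurePreserving (shiftD M N) μ μ)
    (hν : MeasurePreserving (shiftD M N) ν ν) {ε : ℝ} (hε : 0 < ε) (t : ℝ) :
    Ergodic (shiftD M N) (Phi μ ν ε t) := by
  rw [Phi_eq μ ν hε]
  have hphi : MeasurePreserving (phi M N) (kap μ ν) (kap μ ν) :=
    (MeasurePreserving.id unif).prod (hμ.prod hν)
  have herg := prod_tsh_ergodic (MeasurePreserving.id unif) hphi
  have hm : Measurable (fun p : (ℤ → ℝ) × (ℤ → KX M N) => decX (zf ε t p)) :=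
    meas_decX.comp (meas_zf ε t)
  have hmp : MeasurePreserving (fun p : (ℤ → ℝ) × (ℤ → KX M N) => decX (zf ε t p))
    (Pc.prod (PK (kap μ ν))) (Measure.map (fun p => decX (zf ε t p)) (Pc.prod (PK (kap μ ν)))) :=
    ⟨hm, rfl⟩
  refine hmp.ergodic_of_ergodic_semiconj herg meas_shiftD (fun p => ?_)
  simp only [zf_S, decX_shift]

/-- convex mixture -/
lemma map_sel (t : ℝ) : Measure.map (sel t) (kap μ ν) =
    unif (Set.Iio t) • μ + unif (Set.Ici t) • ν := by
  ext s hs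
  rw [Measure.map_apply (meas_sel t) hs]
  have : (sel t : KX M N → _) ⁻¹' s = (Set.Iio t ×ˢ (s ×ˢ Set.univ)) ∪
      (Set.Ici t ×ˢ (Set.univ ×ˢ s)) := by
    ext ⟨v, x, y⟩
    simp only [sel, Set.mem_preimage, Set.mem_union, Set.mem_prod, Set.mem_Iio, Set.mem_Ici,
      Set.mem_univ, and_true, true_and]
    by_cases h : v < t
    · simp [h]
    · simp [h, not_lt.1 h]
  rw [this, measure_union]
  · simp [kap, Measure.prod_prod]
  · rw [Set.disjoint_left]
    rintro ⟨v, x, y⟩ h1 h2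
    exact (not_lt.2 (Set.mem_Ici.1 h2.1)) (Set.mem_Iio.1 h1.1)
  · exact measurableSet_Ici.prod (MeasurableSet.univ.prod hs)

lemma unif_nonneg : ∀ᵐ v ∂unif, 0 ≤ v ∧ v ≤ 1 :=
  ae_restrict_of_forall_mem measurableSet_Icc fun _ hv => hv

lemma unif_add (t : ℝ) : unif (Set.Iio t) + unif (Set.Ici t) = 1 := by
  rw [← Set.compl_Iio]
  exact prob_add_prob_compl measurableSet_Iio

lemma ae_clock {q : ℝ → Prop} (h : ∀ᵐ v ∂unif, q v) :
    ∀ᵐ p ∂(QQ μ ν), ∀ i : ℤ, q (p.1 i) := by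
  have h1 : ∀ᵐ c ∂Pc, ∀ i : ℤ, q (c i) := by
    rw [ae_all_iff]
    intro i
    exact (measurePreserving_eval_infinitePi (fun _ : ℤ => unif) i).quasiMeasurePreserving.ae h
  exact (QQ_fst μ ν).quasiMeasurePreserving.ae h1

lemma Phi_nonpos {ε : ℝ} (hε : ε ≤ 0) (t : ℝ) :
    Phi μ ν ε t = Measure.map (sel t) (kap μ ν) := by
  have h1 : (fun p => decX (zp ε t p)) =ᵐ[QQ μ ν] (sel t) ∘ fun p => p.2.2 := by
    filter_upwards [ae_clock μ ν unif_nonneg] with p hp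
    simp only [Function.comp]
    rw [← decX_val (sel t p.2.2)]
    congr 1
    funext j
    exact zp_of_NoRen t fun l _ _ => hε.trans (hp l).1
  rw [Phi, Measure.map_congr h1, ← Measure.map_map (meas_sel t) (QQ_snd μ ν).measurable,
    (QQ_snd μ ν).map_eq]

lemma int_G (ρ : Measure ↥(SigmaD M N)) [IsProbabilityMeasure ρ] :
    Integrable (fun x => (Gfun x.1 0 : ℝ)) ρ :=
  integrable_int (meas_GX 0) 1 fun x => by have := G_bd x.1 0; rw [abs_le]; omega

lemma drift_Phi (ε t : ℝ) : drift (Phi μ ν ε t) =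
    (unif (Set.Iio t)).toReal * drift μ + (unif (Set.Ici t)).toReal * drift ν := by
  have hG : Measurable (fun x : ↥(SigmaD M N) => (Gfun x.1 0 : ℝ)) :=
    measurable_from_top.comp (meas_GX 0)
  have hGs : Measurable (fun x : KX M N => (Gfun (sel t x).1 0 : ℝ)) := hG.comp (meas_sel t)
  have h1 : drift (Phi μ ν ε t) = drift (Measure.map (sel t) (kap μ ν)) := by
    rw [drift, drift, Phi, integral_map (meas_dz ε t).aemeasurable hG.aestronglyMeasurable,
      integral_map (meas_sel t).aemeasurable hG.aestronglyMeasurable, ← (QQ_snd μ ν).map_eq,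
      integral_map (QQ_snd μ ν).measurable.aemeasurable
        hGs.aestronglyMeasurable]
    refine integral_congr_ae (Eventually.of_forall fun p => ?_)
    simp only
    congr 1
    change Gfun (dec (zp ε t p)) 0 = _
    rw [G_dec]
    simp only [Gfun, zp_zero]
  rw [h1, map_sel, drift, integral_add_measure ((int_G μ).smul_measure (measure_ne_top _ _))
    ((int_G ν).smul_measure (measure_ne_top _ _)), integral_smul_measure, integral_smul_measure]
  rfl

lemma Phi_Asc (hμ : MeasurePreserving (shiftD M N) μ μ)
    (hν : MeasurePreserving (shiftD M N) ν ν) (hμA : ∀ᵐ x ∂μ, Asc x.1) (hνA : ∀ᵐ x ∂ν, Asc x.1)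
    (ε t : ℝ) : ∀ᵐ x ∂(Phi μ ν ε t), Asc x.1 := by
  rcases le_or_gt ε 0 with hε | hε
  · rw [Phi_nonpos μ ν hε, map_sel, ae_add_measure_iff]
    exact ⟨Measure.ae_smul_measure hμA _, Measure.ae_smul_measure hνA _⟩
  · refine Asc_of_drift_pos (Phi_ergodic μ ν hμ hν hε t) ?_
    rw [drift_Phi]
    have h1 := drift_pos_of_Asc hμ hμA
    have h2 := drift_pos_of_Asc hν hνA
    have h3 := congrArg ENNReal.toReal (unif_add t)
    rw [ENNReal.toReal_add (measure_ne_top _ _) (measure_ne_top _ _), ENNReal.toReal_one] at h3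
    have h4 : 0 ≤ (unif (Set.Iio t)).toReal := ENNReal.toReal_nonneg
    have h5 : 0 ≤ (unif (Set.Ici t)).toReal := ENNReal.toReal_nonneg
    rcases h4.eq_or_lt with h6 | h6
    · rw [← h6] at h3 ⊢
      nlinarith
    · have := mul_pos h6 h1
      have := mul_nonneg h5 h2.le
      linarith

end Meas
end DMP

open MeasureTheory Topology Filter
open scoped ENNReal NNReal
namespace DMP
set_option linter.unusedSectionVars false

/-! ### Continuity of the interpolating family -/

variable {M N : ℕ}

lemma ev_cmp {a ε : ℝ} (h : a ≠ ε) : ∀ᶠ ε' in 𝓝 ε, (a < ε' ↔ a < ε) := by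
  rcases lt_or_gt_of_ne h with h | h
  · filter_upwards [lt_mem_nhds h] with e he
    simp [he, h]
  · filter_upwards [gt_mem_nhds h] with e he
    exact iff_of_false (not_lt.2 (le_of_lt he)) (not_lt.2 (le_of_lt h))

lemma ev_cmp_Icc {c : ℤ → ℝ} {ε : ℝ} (h : ∀ i, c i ≠ ε) (i j : ℤ) :
    ∀ᶠ ε' in 𝓝 ε, ∀ l ∈ Set.Icc i j, (c l < ε' ↔ c l < ε) :=
  (Set.finite_Icc i j).eventually_all.2 fun l _ => ev_cmp (h l)

lemma ev_NoRen {c : ℤ → ℝ} {ε : ℝ} (h : ∀ i, c i ≠ ε) (j : ℤ) :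
    ∀ᶠ ε' in 𝓝 ε, (NoRen ε' c j ↔ NoRen ε c j) := by
  filter_upwards [ev_cmp_Icc h (min 0 j) (max 0 j)] with ε' he
  unfold NoRen
  refine forall₃_congr fun l h1 h2 => ?_
  rw [← not_lt, ← not_lt, he l ⟨h1.le, h2⟩]

lemma ev_tau {c : ℤ → ℝ} {ε : ℝ} (h : ∀ i, c i ≠ ε) (hG : Good ε c) (j : ℤ) :
    ∀ᶠ ε' in 𝓝 ε, tau ε' c j = tau ε c j := by
  obtain ⟨h1, h2⟩ := tau_spec' (hG j)
  have h3 := tau_le ε c j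
  filter_upwards [ev_cmp_Icc h (tau ε c j) j] with ε' he
  refine tau_unique h3 ((he _ ⟨le_rfl, h3⟩).2 h1) fun l hl hl' => ?_
  rw [← not_lt, he l ⟨hl.le, hl'⟩, not_lt]
  exact h2 l hl hl'

lemma ev_sel {k : KX M N} {t : ℝ} (h : k.1 ≠ t) : ∀ᶠ t' in 𝓝 t, sel t' k = sel t k := by
  filter_upwards [ev_cmp h] with t' ht
  simp only [sel, ht]

lemma ev_zp {p : (ℤ → ℝ) × ((ℤ → KX M N) × KX M N)} {e : ℝ × ℝ} (hc : ∀ i, p.1 i ≠ e.1)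
    (hK : ∀ i, (p.2.1 i).1 ≠ e.2) (hk : p.2.2.1 ≠ e.2)
    (hG : (∀ i, e.1 ≤ p.1 i) ∨ Good e.1 p.1) (j : ℤ) :
    ∀ᶠ e' in 𝓝 e, zp e'.1 e'.2 p j = zp e.1 e.2 p j := by
  have c1 : Tendsto Prod.fst (𝓝 e) (𝓝 e.1) := continuous_fst.tendsto e
  have c2 : Tendsto Prod.snd (𝓝 e) (𝓝 e.2) := continuous_snd.tendsto e
  have h1 := c1.eventually (ev_NoRen hc j)
  by_cases hN : NoRen e.1 p.1 j
  · filter_upwards [h1, c2.eventually (ev_sel hk)] with e' h1 h2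
    rw [zp_of_NoRen _ hN, zp_of_NoRen _ (h1.2 hN), h2]
  · have hG : Good e.1 p.1 := hG.resolve_left fun h => hN fun l _ _ => h l
    filter_upwards [h1, c1.eventually (ev_tau hc hG j),
      c2.eventually (ev_sel (hK (tau e.1 p.1 j)))] with e' h1 h2 h3
    simp only [zp, if_neg hN, if_neg (mt h1.1 hN), h2, h3]

lemma tendsto_dz {p : (ℤ → ℝ) × ((ℤ → KX M N) × KX M N)} {e : ℝ × ℝ} (hc : ∀ i, p.1 i ≠ e.1)
    (hK : ∀ i, (p.2.1 i).1 ≠ e.2) (hk : p.2.2.1 ≠ e.2)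
    (hG : (∀ i, e.1 ≤ p.1 i) ∨ Good e.1 p.1)
    (hA : Tendsto (Hfun (zp e.1 e.2 p)) atBot atBot) :
    Tendsto (fun e' : ℝ × ℝ => decX (zp e'.1 e'.2 p)) (𝓝 e) (𝓝 (decX (zp e.1 e.2 p))) := by
  rw [tendsto_subtype_rng, tendsto_pi_nhds]
  intro j
  obtain ⟨i, hi⟩ := dec_local hA j
  refine tendsto_const_nhds.congr' ?_
  have h := (Set.finite_Icc i j).eventually_all.2 fun l _ => ev_zp hc hK hk hG l
  filter_upwards [h] with e' he
  exact (hi _ fun l h1 h2 => (he l ⟨h1, h2⟩).symm).symm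

section Meas
variable (μ ν : Measure ↥(SigmaD M N)) [IsProbabilityMeasure μ] [IsProbabilityMeasure ν]

lemma unif_ne (a : ℝ) : ∀ᵐ v ∂unif, v ≠ a := Measure.ae_ne unif a

lemma kap_ne (a : ℝ) : ∀ᵐ k ∂(kap μ ν), k.1 ≠ a := by
  have : MeasurePreserving Prod.fst (kap μ ν) unif := measurePreserving_fst
  exact this.quasiMeasurePreserving.ae (unif_ne a)

lemma QQ_ne (a : ℝ) : ∀ᵐ p ∂(QQ μ ν), ∀ i, (p.2.1 i).1 ≠ a := by
  rw [ae_all_iff]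
  intro i
  have h1 : MeasurePreserving Prod.snd (QQ μ ν) ((PK (kap μ ν)).prod (kap μ ν)) :=
    measurePreserving_snd
  have h2 : MeasurePreserving Prod.fst ((PK (kap μ ν)).prod (kap μ ν)) (PK (kap μ ν)) :=
    measurePreserving_fst
  have h3 := measurePreserving_eval_infinitePi (fun _ : ℤ => kap μ ν) i
  exact ((h3.comp h2).comp h1).quasiMeasurePreserving.ae (kap_ne μ ν a)

/-- the family as probability measures -/
noncomputable def PhiP (e : ℝ × ℝ) : ProbabilityMeasure ↥(SigmaD M N) :=
  ⟨Phi μ ν e.1 e.2, inferInstance⟩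

lemma PhiP_cont (hμ : MeasurePreserving (shiftD M N) μ μ)
    (hν : MeasurePreserving (shiftD M N) ν ν) (hμA : ∀ᵐ x ∂μ, Asc x.1)
    (hνA : ∀ᵐ x ∂ν, Asc x.1) : Continuous (PhiP μ ν) := by
  rw [continuous_iff_continuousAt]
  intro e
  refine ProbabilityMeasure.tendsto_iff_forall_integral_tendsto.2 fun f => ?_
  have hi : ∀ e' : ℝ × ℝ, ∫ x, f x ∂((PhiP μ ν e' : ProbabilityMeasure _) : Measure _) =
      ∫ p, f (decX (zp e'.1 e'.2 p)) ∂(QQ μ ν) := fun e' =>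
    integral_map (meas_dz e'.1 e'.2).aemeasurable f.continuous.measurable.aestronglyMeasurable
  simp only [hi]
  refine tendsto_integral_filter_of_dominated_convergence (fun _ => ‖f‖) ?_ ?_
    (integrable_const _) ?_
  · exact Eventually.of_forall fun e' =>
      (f.continuous.measurable.comp (meas_dz e'.1 e'.2)).aestronglyMeasurable
  · exact Eventually.of_forall fun e' => Eventually.of_forall fun p => f.norm_coe_le_norm _
  · have hA := Phi_Asc μ ν hμ hν hμA hνA e.1 e.2
    have hA' : ∀ᵐ p ∂(QQ μ ν), Asc (decX (zp e.1 e.2 p)).1 :=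
      ae_of_ae_map (meas_dz e.1 e.2).aemeasurable hA
    have hG : ∀ᵐ p ∂(QQ μ ν), (∀ i, e.1 ≤ p.1 i) ∨ Good e.1 p.1 := by
      rcases le_or_gt e.1 0 with h | h
      · filter_upwards [ae_clock μ ν unif_nonneg] with p hp
        exact Or.inl fun i => h.trans (hp i).1
      · filter_upwards [(QQ_fst μ ν).quasiMeasurePreserving.ae (ae_Good h)] with p hp
        exact Or.inr hp
    filter_upwards [hA', hG, QQ_ne μ ν e.2, ae_clock μ ν (unif_ne e.1),
      (QQ_snd μ ν).quasiMeasurePreserving.ae (kap_ne μ ν e.2)] with p h1 h2 h3 h4 h5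
    have h6 : Tendsto (Hfun (dec (zp e.1 e.2 p))) atBot atBot := h1.2
    rw [H_dec] at h6
    exact (f.continuous.tendsto _).comp (tendsto_dz h4 h3 h5 h2 h6)

end Meas
end DMP

open MeasureTheory Topology Filter
open scoped ENNReal NNReal
namespace DMP
set_option linter.unusedSectionVars false
set_option linter.deprecated false

/-! ### Path connectedness -/

variable {M N : ℕ}

/-- embedding into a locally convex space -/
noncomputable def FF (μ : ProbabilityMeasure ↥(SigmaD M N)) :
    (BoundedContinuousFunction ↥(SigmaD M N) ℝ) → ℝ :=
  fun f => ∫ x, f x ∂(μ : Measure ↥(SigmaD M N))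

lemma FF_inducing : IsInducing (FF (M := M) (N := N)) := by
  rw [isInducing_iff_nhds]
  intro μ
  refine le_antisymm ?_ ?_
  · rw [← tendsto_iff_comap]
    exact tendsto_pi_nhds.2 (ProbabilityMeasure.tendsto_iff_forall_integral_tendsto.1 tendsto_id)
  · have h : Tendsto id (comap FF (𝓝 (FF μ))) (𝓝 μ) :=
      ProbabilityMeasure.tendsto_iff_forall_integral_tendsto.2
        (tendsto_pi_nhds.1 (tendsto_comap (f := FF (M := M) (N := N)) (x := 𝓝 (FF μ))))
    exact h

lemma mem_MeAl {μ : ProbabilityMeasure ↥(SigmaD M N)} :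
    μ ∈ MeAl M N ↔ Ergodic (shiftD M N) (μ : Measure ↥(SigmaD M N)) ∧
      ∀ᵐ x ∂(μ : Measure ↥(SigmaD M N)), Asc x.1 := by
  simp only [MeAl, MergD, ErgMeas, Set.mem_ofPred_eq]
  exact and_congr Iff.rfl ae_Asc_iff

lemma unif_Iio_zero : unif (Set.Iio 0) = 0 := by
  rw [unif, Measure.restrict_apply measurableSet_Iio]
  convert measure_empty (μ := (volume : Measure ℝ))
  ext x
  simp only [Set.mem_inter_iff, Set.mem_Iio, Set.mem_Icc, Set.mem_empty_iff_false, iff_false]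
  intro h
  linarith [h.1, h.2.1]

lemma unif_Ici_one : unif (Set.Ici 1) = 0 := by
  rw [unif, Measure.restrict_apply measurableSet_Ici]
  refine measure_mono_null (t := {1}) (fun x hx => ?_) (by simp)
  exact le_antisymm hx.2.2 hx.1

lemma join_convex {μ ν : ProbabilityMeasure ↥(SigmaD M N)} (hμ : μ ∈ MeAl M N)
    (hν : ν ∈ MeAl M N) {C : Set ((BoundedContinuousFunction ↥(SigmaD M N) ℝ) → ℝ)}
    (hCo : IsOpen C) (hC : Convex ℝ C) (hμC : FF μ ∈ C) (hνC : FF ν ∈ C) :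
    JoinedIn (MeAl M N ∩ FF ⁻¹' C) ν μ := by
  rw [mem_MeAl] at hμ hν
  set P := PhiP (μ : Measure ↥(SigmaD M N)) (ν : Measure ↥(SigmaD M N)) with hP
  have hcont : Continuous P := PhiP_cont _ _ hμ.1.toMeasurePreserving hν.1.toMeasurePreserving
    hμ.2 hν.2
  have hP0 : P (0, 0) = ν := by
    refine Subtype.ext ?_
    change Phi _ _ (0 : ℝ) (0 : ℝ) = _
    have h := unif_add 0
    rw [unif_Iio_zero, zero_add] at h
    rw [Phi_nonpos _ _ le_rfl, map_sel, unif_Iio_zero, h, zero_smul, zero_add, one_smul]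
    rfl
  have hP1 : P (0, 1) = μ := by
    refine Subtype.ext ?_
    change Phi _ _ (0 : ℝ) (1 : ℝ) = _
    have h := unif_add 1
    rw [unif_Ici_one, add_zero] at h
    rw [Phi_nonpos _ _ le_rfl, map_sel, unif_Ici_one, h, zero_smul, add_zero, one_smul]
    rfl
  have hPC : ∀ t, FF (P (0, t)) ∈ C := by
    intro t
    have h3 := congrArg ENNReal.toReal (unif_add t)
    rw [ENNReal.toReal_add (measure_ne_top _ _) (measure_ne_top _ _), ENNReal.toReal_one] at h3
    have : FF (P (0, t)) = (unif (Set.Iio t)).toReal • FF μ + (unif (Set.Ici t)).toReal • FF ν := by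
      funext f
      change ∫ x, f x ∂(Phi _ _ (0 : ℝ) t) = _
      rw [Phi_nonpos _ _ le_rfl, map_sel, integral_add_measure
        ((f.integrable _).smul_measure (measure_ne_top _ _))
        ((f.integrable _).smul_measure (measure_ne_top _ _)), integral_smul_measure,
        integral_smul_measure]
      rfl
    rw [this]
    exact hC hμC hνC ENNReal.toReal_nonneg ENNReal.toReal_nonneg h3
  have hUo : IsOpen ((fun e => FF (P e)) ⁻¹' C) :=
    hCo.preimage (FF_inducing.continuous.comp hcont)
  obtain ⟨u, v, hu, hv, h0u, h1v, huv⟩ := generalized_tube_lemma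
    (isCompact_singleton (x := (0 : ℝ))) (isCompact_Icc (a := (0 : ℝ)) (b := 1)) hUo (by
      rintro ⟨a, b⟩ ⟨ha, hb⟩
      rw [Set.mem_singleton_iff] at ha
      dsimp only at ha
      subst ha
      exact hPC b)
  obtain ⟨r, hr, hru⟩ := Metric.isOpen_iff.1 hu 0 (h0u rfl)
  refine JoinedIn.ofLine (f := fun s : ℝ => P (r / 2 * (s * (1 - s)), s)) ?_ ?_ ?_ ?_
  · exact (hcont.comp (by fun_prop)).continuousOn
  · simpa using hP0
  · simpa using hP1
  · rintro _ ⟨s, hs, rfl⟩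
    have hs0 : 0 ≤ s := hs.1
    have hs1 : s ≤ 1 := hs.2
    have hq : 0 ≤ s * (1 - s) := mul_nonneg hs0 (by linarith)
    have hq1 : s * (1 - s) ≤ 1 := by nlinarith
    refine ⟨?_, huv (Set.mk_mem_prod (hru ?_) (h1v hs))⟩
    · rcases hs0.eq_or_lt with h | h
      · subst h
        simp only [zero_mul, mul_zero]
        rw [hP0, mem_MeAl]
        exact hν
      rcases hs1.eq_or_lt with h' | h'
      · subst h'
        simp only [sub_self, mul_zero]
        rw [hP1, mem_MeAl]
        exact hμ
      · rw [mem_MeAl]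
        have hpos : 0 < r / 2 * (s * (1 - s)) :=
          mul_pos (by linarith) (mul_pos h (by linarith))
        exact ⟨Phi_ergodic _ _ hμ.1.toMeasurePreserving hν.1.toMeasurePreserving hpos s,
          Phi_Asc _ _ hμ.1.toMeasurePreserving hν.1.toMeasurePreserving hμ.2 hν.2 _ s⟩
    · rw [Metric.mem_ball, Real.dist_eq, sub_zero, abs_of_nonneg (by positivity)]
      nlinarith

/-- constant sequence -/
def constLa (N : ℕ) {M : ℕ} (k : Fin M) : ℤ → DMSym M N := fun _ => .la k

lemma H_const (k : Fin M) (i : ℤ) : Hfun (constLa N k) i = i := by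
  have hG : ∀ i, Gfun (constLa N k) i = 1 := fun i => rfl
  induction i using Int.induction_on with
  | zero => simp [H_zero]
  | succ n ih => rw [H_succ, ih, hG]
  | pred n ih =>
    have := H_succ (constLa N k) (-(n : ℤ) - 1)
    rw [sub_add_cancel, ih, hG] at this
    omega

lemma dirac_ergodic {Ω : Type*} [MeasurableSpace Ω] {T : Ω → Ω} (hT : Measurable T) {x : Ω}
    (hx : T x = x) : Ergodic T (Measure.dirac x) := by
  refine { measurable := hT, map_eq := by rw [Measure.map_dirac' hT, hx], aeconst_set := ?_ }
  intro s hs _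
  rw [eventuallyConst_set']
  by_cases h : x ∈ s
  · right
    rw [eventuallyEq_univ, mem_ae_iff, Measure.dirac_apply' _ hs.compl]
    simp [h]
  · left
    rw [ae_eq_empty, Measure.dirac_apply' _ hs]
    simp [h]

lemma MeAl_nonempty (hM : 2 ≤ M) : (MeAl M N).Nonempty := by
  let k : Fin M := ⟨0, by omega⟩
  have hc : constLa N k ∈ SigmaD M N := by
    have h := dec_mem (constLa N k)
    have h2 : dec (constLa N k) = constLa N k := funext fun j => dec_la rfl
    rwa [h2] at h
  let x : ↥(SigmaD M N) := ⟨constLa N k, hc⟩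
  refine ⟨⟨Measure.dirac x, inferInstance⟩, mem_MeAl.2 ⟨?_, ?_⟩⟩
  · exact dirac_ergodic meas_shiftD rfl
  · have hA : Asc x.1 := by
      have : Hfun x.1 = id := funext fun i => H_const k i
      unfold Asc
      rw [this]
      exact ⟨tendsto_id, tendsto_id⟩
    have hm : MeasurableSet {y : ↥(SigmaD M N) | Asc y.1} := measurable_subtype_coe meas_Asc
    exact (ae_dirac_iff hm).2 hA

lemma pc_MeAl_inter (hM : 2 ≤ M) {C : Set ((BoundedContinuousFunction ↥(SigmaD M N) ℝ) → ℝ)}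
    (hCo : IsOpen C) (hC : Convex ℝ C) (hne : (MeAl M N ∩ FF ⁻¹' C).Nonempty) :
    IsPathConnected (MeAl M N ∩ FF ⁻¹' C) := by
  obtain ⟨μ, hμ⟩ := hne
  exact ⟨μ, hμ, fun {ν} hν => join_convex hν.1 hμ.1 hCo hC hν.2 hμ.2⟩

theorem MeAl_pc (hM : 2 ≤ M) : PathConnectedSpace ↥(MeAl M N) := by
  rw [← isPathConnected_iff_pathConnectedSpace]
  have := pc_MeAl_inter hM (N := N) isOpen_univ convex_univ (by simpa using MeAl_nonempty hM)
  simpa using this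

theorem MeAl_lpc (hM : 2 ≤ M) : LocallyPathConnectedSpace ↥(MeAl M N) := by
  have hind : IsInducing (fun μ : ↥(MeAl M N) => FF μ.1) := FF_inducing.comp IsInducing.subtypeVal
  refine LocallyPathConnectedSpace.of_bases
    (p := fun (μ : ↥(MeAl M N)) (C : Set ((BoundedContinuousFunction ↥(SigmaD M N) ℝ) → ℝ)) =>
      FF μ.1 ∈ C ∧ IsOpen C ∧ Convex ℝ C)
    (s := fun (_ : ↥(MeAl M N)) C => (fun μ : ↥(MeAl M N) => FF μ.1) ⁻¹' C) ?_ ?_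
  · intro μ
    rw [hind.nhds_eq_comap]
    have hb : (𝓝 (FF μ.1)).HasBasis
        (fun C : Set ((BoundedContinuousFunction ↥(SigmaD M N) ℝ) → ℝ) =>
          FF μ.1 ∈ C ∧ IsOpen C ∧ Convex ℝ C) id :=
      (LocallyConvexSpace.convex_basis (𝕜 := ℝ) (FF μ.1)).to_hasBasis
        (fun s hs => ⟨interior s, ⟨mem_interior_iff_mem_nhds.mpr hs.1, isOpen_interior,
          hs.2.interior⟩, interior_subset⟩)
        (fun s hs => ⟨s, ⟨hs.2.1.mem_nhds hs.1, hs.2.2⟩, subset_rfl⟩)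
    exact hb.comap _
  · rintro μ C ⟨h1, h2, h3⟩
    rw [IsInducing.subtypeVal.isPathConnected_iff]
    have : Subtype.val '' ((fun μ : ↥(MeAl M N) => FF μ.1) ⁻¹' C) = MeAl M N ∩ FF ⁻¹' C := by
      ext ν
      simp only [Set.mem_image, Set.mem_preimage, Subtype.exists, exists_and_left, exists_prop,
        exists_eq_right_right, Set.mem_inter_iff]
      tauto
    rw [this]
    exact pc_MeAl_inter hM h2 h3 ⟨μ.1, μ.2, h1⟩

end DMP

open MeasureTheory Topology Filter
open scoped ENNReal NNReal
namespace DMP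
set_option linter.unusedSectionVars false
set_option linter.deprecated false

/-! ### Time reversal -/

variable {M N : ℕ}

/-- exchange left and right brackets -/
def flipS : DMSym M N → DMSym M N
  | .la k => .ra k
  | .u k => .u k
  | .ra k => .la k

lemma flipS_flipS (a : DMSym M N) : flipS (flipS a) = a := by cases a <;> rfl

/-- time reversal -/
def rv (x : ℤ → DMSym M N) : ℤ → DMSym M N := fun i => flipS (x (-i))

lemma rv_rv (x : ℤ → DMSym M N) : rv (rv x) = x := by
  funext i
  simp [rv, flipS_flipS]

lemma G_rv (x : ℤ → DMSym M N) (i : ℤ) : Gfun (rv x) i = - Gfun x (-i) := by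
  unfold Gfun rv
  rcases x (-i) with k | k | k <;> simp [flipS]

lemma H_rv (x : ℤ → DMSym M N) (i : ℤ) : Hfun (rv x) i = Hfun x (1 - i) - Hfun x 1 := by
  have hs : ∀ i, Hfun (rv x) (i + 1) - Hfun (rv x) i = Hfun x (1 - (i + 1)) - Hfun x (1 - i) := by
    intro i
    have h1 := H_succ (rv x) i
    have h2 := H_succ x (-i)
    rw [G_rv] at h1
    rw [show 1 - (i + 1) = -i by ring, show 1 - i = -i + 1 by ring]
    omega
  induction i using Int.induction_on with
  | zero => simp [H_zero]
  | succ n ih => have := hs n; omega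
  | pred n ih =>
    have := hs (-(n : ℤ) - 1)
    rw [sub_add_cancel] at this
    omega

lemma matched_rv {x : ℤ → DMSym M N} {i j : ℤ} (h : Matched (rv x) i j) :
    Matched x (-j) (-i) := by
  obtain ⟨h1, h2, h3⟩ := h
  simp only [H_rv] at h2 h3
  refine ⟨by omega, ?_, ?_⟩
  · rw [show 1 - (j + 1) = -j by ring, show 1 - i = -i + 1 by ring] at h2
    omega
  · intro l hl hl'
    have := h3 (1 - l) (by omega) (by omega)
    rw [sub_sub_cancel] at this
    rw [show 1 - (j + 1) = -j by ring] at h2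
    omega

lemma rv_mem {x : ℤ → DMSym M N} (hx : x ∈ SigmaD M N) : rv x ∈ SigmaD M N := by
  rw [mem_iff] at hx ⊢
  intro i j a b hm hi hj
  refine (hx (-j) (-i) b a (matched_rv hm) ?_ ?_).symm
  · have := congrArg flipS hj
    rwa [rv, flipS_flipS] at this
  · have := congrArg flipS hi
    rwa [rv, flipS_flipS] at this

/-- time reversal on the shift space -/
def rvX (x : ↥(SigmaD M N)) : ↥(SigmaD M N) := ⟨rv x.1, rv_mem x.2⟩

lemma rvX_rvX (x : ↥(SigmaD M N)) : rvX (rvX x) = x := Subtype.ext (rv_rv x.1)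

lemma cont_rvX : Continuous (rvX : ↥(SigmaD M N) → ↥(SigmaD M N)) := by
  refine Continuous.subtype_mk (continuous_pi fun i => ?_) _
  exact (continuous_of_discreteTopology (f := (flipS : DMSym M N → DMSym M N))).comp
    ((continuous_apply (-i)).comp continuous_subtype_val)

lemma meas_rvX : Measurable (rvX : ↥(SigmaD M N) → ↥(SigmaD M N)) := by
  refine Measurable.subtype_mk (measurable_pi_lambda _ fun i => ?_)
  have hf : Measurable (flipS : DMSym M N → DMSym M N) := fun _ _ => trivial
  exact hf.comp ((measurable_pi_apply (-i)).comp measurable_subtype_coe)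

lemma rvX_shift (x : ↥(SigmaD M N)) : rvX (shiftD M N x) = (shiftE M N).symm (rvX x) := by
  refine Subtype.ext (funext fun i => ?_)
  change flipS (x.1 (-i + 1)) = flipS (x.1 (-(i - 1)))
  rw [show -i + 1 = -(i - 1) by ring]

/-- time reversal as a measurable equivalence -/
def rvE (M N : ℕ) : ↥(SigmaD M N) ≃ᵐ ↥(SigmaD M N) where
  toFun := rvX
  invFun := rvX
  left_inv := rvX_rvX
  right_inv := rvX_rvX
  measurable_toFun := meas_rvX
  measurable_invFun := meas_rvX

lemma ergodic_rv {μ : Measure ↥(SigmaD M N)} (h : Ergodic (shiftD M N) μ) :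
    Ergodic (shiftD M N) (μ.map rvX) := by
  have h1 : MeasurePreserving rvX μ (μ.map rvX) := ⟨meas_rvX, rfl⟩
  have h2 : Ergodic ((shiftE M N).symm) (μ.map rvX) :=
    h1.ergodic_of_ergodic_semiconj h (shiftE M N).symm.measurable rvX_shift
  exact Ergodic.symm (e := (shiftE M N).symm) h2

lemma tendsto_H_rv {x : ℤ → DMSym M N} {l : Filter ℤ} :
    (Tendsto (Hfun x) atBot l → Tendsto (fun i => Hfun (rv x) i + Hfun x 1) atTop l) ∧
    (Tendsto (Hfun x) atTop l → Tendsto (fun i => Hfun (rv x) i + Hfun x 1) atBot l) := by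
  have e : (fun i => Hfun (rv x) i + Hfun x 1) = Hfun x ∘ (fun i => 1 + -i) := by
    funext i
    simp [H_rv, sub_eq_add_neg]
  rw [e]
  exact ⟨fun h => h.comp (tendsto_atBot_add_const_left _ _ tendsto_neg_atTop_atBot),
    fun h => h.comp (tendsto_atTop_add_const_left _ _ tendsto_neg_atBot_atTop)⟩

lemma tendsto_add_const_top {f : ℤ → ℤ} {c : ℤ} {l : Filter ℤ}
    (h : Tendsto (fun i => f i + c) l atTop) : Tendsto f l atTop := by
  have := tendsto_atTop_add_const_right l (-c) h
  simpa using this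

lemma tendsto_add_const_bot {f : ℤ → ℤ} {c : ℤ} {l : Filter ℤ}
    (h : Tendsto (fun i => f i + c) l atBot) : Tendsto f l atBot := by
  have := tendsto_atBot_add_const_right l (-c) h
  simpa using this

lemma rv_Abeta {x : ℤ → DMSym M N} (h : x ∈ AalphaSet M N) : rv x ∈ AbetaSet M N :=
  ⟨rv_mem h.1, tendsto_add_const_bot (tendsto_H_rv.1 h.2.2),
    tendsto_add_const_top (tendsto_H_rv.2 h.2.1)⟩

lemma rv_Aalpha {x : ℤ → DMSym M N} (h : x ∈ AbetaSet M N) : rv x ∈ AalphaSet M N :=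
  ⟨rv_mem h.1, tendsto_add_const_top (tendsto_H_rv.1 h.2.2),
    tendsto_add_const_bot (tendsto_H_rv.2 h.2.1)⟩

/-- push-forward under time reversal -/
noncomputable def rvP (μ : ProbabilityMeasure ↥(SigmaD M N)) :
    ProbabilityMeasure ↥(SigmaD M N) := μ.map meas_rvX.aemeasurable

lemma rvP_coe (μ : ProbabilityMeasure ↥(SigmaD M N)) :
    (rvP μ : Measure ↥(SigmaD M N)) = (μ : Measure ↥(SigmaD M N)).map rvX := rfl

lemma rvP_rvP (μ : ProbabilityMeasure ↥(SigmaD M N)) : rvP (rvP μ) = μ := by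
  refine Subtype.ext ?_
  change (rvP (rvP μ) : Measure ↥(SigmaD M N)) = (μ : Measure ↥(SigmaD M N))
  rw [rvP_coe, rvP_coe, Measure.map_map meas_rvX meas_rvX]
  have : (rvX ∘ rvX : ↥(SigmaD M N) → ↥(SigmaD M N)) = id := funext rvX_rvX
  rw [this, Measure.map_id]

lemma cont_rvP : Continuous (rvP (M := M) (N := N)) :=
  ProbabilityMeasure.continuous_map cont_rvX

lemma rvP_apply (μ : ProbabilityMeasure ↥(SigmaD M N)) (s : Set ↥(SigmaD M N)) :
    (rvP μ : Measure ↥(SigmaD M N)) s = (μ : Measure ↥(SigmaD M N)) (rvX ⁻¹' s) := by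
  rw [rvP_coe]
  exact (rvE M N).map_apply s

lemma rvP_MeBe {μ : ProbabilityMeasure ↥(SigmaD M N)} (h : μ ∈ MeAl M N) : rvP μ ∈ MeBe M N := by
  refine ⟨ergodic_rv h.1, ?_⟩
  refine le_antisymm prob_le_one ?_
  have h2 := h.2
  change 1 ≤ (rvP μ : Measure ↥(SigmaD M N)) _
  rw [rvP_apply, ← h2]
  exact measure_mono fun x hx => rv_Abeta hx

lemma rvP_MeAl {μ : ProbabilityMeasure ↥(SigmaD M N)} (h : μ ∈ MeBe M N) : rvP μ ∈ MeAl M N := by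
  refine ⟨ergodic_rv h.1, ?_⟩
  refine le_antisymm prob_le_one ?_
  have h2 := h.2
  change 1 ≤ (rvP μ : Measure ↥(SigmaD M N)) _
  rw [rvP_apply, ← h2]
  exact measure_mono fun x hx => rv_Aalpha hx

/-- the two spaces of measures are homeomorphic -/
noncomputable def rvH (M N : ℕ) : ↥(MeAl M N) ≃ₜ ↥(MeBe M N) where
  toFun μ := ⟨rvP μ.1, rvP_MeBe μ.2⟩
  invFun μ := ⟨rvP μ.1, rvP_MeAl μ.2⟩
  left_inv μ := Subtype.ext (rvP_rvP μ.1)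
  right_inv μ := Subtype.ext (rvP_rvP μ.1)
  continuous_toFun := (cont_rvP.comp continuous_subtype_val).subtype_mk _
  continuous_invFun := (cont_rvP.comp continuous_subtype_val).subtype_mk _

theorem MeBe_pc (hM : 2 ≤ M) : PathConnectedSpace ↥(MeBe M N) := by
  haveI := MeAl_pc (N := N) hM
  exact (rvH M N).surjective.pathConnectedSpace (rvH M N).continuous

theorem MeBe_lpc (hM : 2 ≤ M) : LocallyPathConnectedSpace ↥(MeBe M N) := by
  haveI := MeAl_lpc (N := N) hM
  exact (rvH M N).symm.isOpenEmbedding.locallyPathConnectedSpace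

end DMP

/-- Proposition 3.4: the spaces `M^e_α(Σ_D)` and `M^e_β(Σ_D)` are path connected and
locally path connected. -/
theorem MeAl_MeBe_pathConnected (M N : ℕ) (hM : 2 ≤ M) :
    PathConnectedSpace ↥(MeAl M N) ∧ LocPathConnectedSpace ↥(MeAl M N) ∧
    PathConnectedSpace ↥(MeBe M N) ∧ LocPathConnectedSpace ↥(MeBe M N) := by
  exact ⟨DMP.MeAl_pc hM, DMP.MeAl_lpc hM, DMP.MeBe_pc hM, DMP.MeBe_lpc hM⟩
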